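/- arXiv:2404.10750 — 2 statements merged into one kernel-verified Lean document; each statement's English description precedes it below -/
import Mathlib

section
/- Let k be a positive integer. Every (simple, undirected) graph G on n vertices with more than (k−1)·n/2 edges contains every caterpillar with k edges as a subgraph, i.e., for every caterpillar T with exactly k edges there is an injective map f : V(T) → V(G) with f(x)f(y) an edge of G whenever xy is an edge of T. -/
open Finset

section Defs

variable {V W : Type*}

/-- Number of arcs of a digraph given by a Boolean adjacency relation. -/
def arcCount [Fintype V] (A : V → V → Bool) : ℕ :=
  ((univ : Finset (V × V)).filter (fun p => A p.1 p.2)).card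

/-- Out-neighbourhood. -/
def outNbr [Fintype V] (A : V → V → Bool) (a : V) : Finset V :=
  univ.filter (fun v => A a v)

/-- In-neighbourhood. -/
def inNbr [Fintype V] (A : V → V → Bool) (a : V) : Finset V :=
  univ.filter (fun v => A v a)

/-- Neighbourhood with a sign: `true` = out, `false` = in. -/
def nbr [Fintype V] (A : V → V → Bool) (sign : Bool) (a : V) : Finset V :=
  if sign then outNbr A a else inNbr A a

/-- Total degree (out-degree plus in-degree). -/
def totalDeg [Fintype V] (A : V → V → Bool) (a : V) : ℕ :=
  (outNbr A a).card + (inNbr A a).card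

/-- Maximum total degree `Δ`. -/
def maxDeg [Fintype V] (A : V → V → Bool) : ℕ :=
  univ.sup (totalDeg A)

/-- Second largest element `Δ₂` of the multiset of total degrees. -/
def secondMaxDeg [Fintype V] (A : V → V → Bool) : ℕ :=
  (((univ : Finset V).val.map (totalDeg A)).erase (maxDeg A)).sup

/-- Loopless digraph. -/
def Loopless (A : V → V → Bool) : Prop := ∀ v, ¬ A v v

/-- Antidirected digraph: no directed path with two arcs. -/
def Antidirected (A : V → V → Bool) : Prop := ∀ x y z, A x y → A y z → False

/-- The underlying (undirected) simple graph of a digraph. -/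
def underG (A : V → V → Bool) : SimpleGraph V :=
  SimpleGraph.fromRel (fun x y => A x y)

/-- `𝒦_{2,s}`-freeness: no two distinct vertices `a`, `b` together with signs and `s`
distinct vertices (all different from `a` and `b`) lying in both signed neighbourhoods. -/
def K2sFree [Fintype V] [DecidableEq V] (A : V → V → Bool) (s : ℕ) : Prop :=
  ¬ ∃ (a b : V) (sa sb : Bool) (S : Finset V), a ≠ b ∧ S.card = s ∧
      a ∉ S ∧ b ∉ S ∧ S ⊆ nbr A sa a ∩ nbr A sb b

/-- `T` embeds in `A`: there is an injective arc-preserving map. -/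
def Embeds (T : W → W → Bool) (A : V → V → Bool) : Prop :=
  ∃ f : W → V, Function.Injective f ∧ ∀ x y, T x y → A (f x) (f y)

/-- Vertices of positive out-degree. -/
def outVerts [Fintype V] (A : V → V → Bool) : Finset V :=
  univ.filter (fun v => (outNbr A v).card ≠ 0)

/-- Vertices of positive in-degree. -/
def inVerts [Fintype V] (A : V → V → Bool) : Finset V :=
  univ.filter (fun v => (inNbr A v).card ≠ 0)

/-- A caterpillar: a tree with a path such that every vertex is on the path
or adjacent to it. -/
def IsCaterpillarG {X : Type*} (G : SimpleGraph X) : Prop :=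
  G.IsTree ∧ ∃ (x y : X) (P : G.Walk x y), P.IsPath ∧
    ∀ v, v ∈ P.support ∨ ∃ w ∈ P.support, G.Adj v w

/-- Minimum pseudo-semidegree at least `m`: at least one arc, and every
out-degree and in-degree is `0` or at least `m`. -/
def MinPseudoSemidegGe [Fintype V] (A : V → V → Bool) (m : ℕ) : Prop :=
  0 < arcCount A ∧ (∀ v, (outNbr A v).card = 0 ∨ m ≤ (outNbr A v).card) ∧
    (∀ v, (inNbr A v).card = 0 ∨ m ≤ (inNbr A v).card)

/-- `D'` is a subdigraph of `D` with vertex set `S`. -/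
def SubdigraphOn (D : V → V → Bool) (S : Finset V) (D' : V → V → Bool) : Prop :=
  ∀ x y, D' x y → D x y ∧ x ∈ S ∧ y ∈ S

/-- The vertex set of the double broom `B_{uv}(T)`: the path joining `u` and `v`
together with all neighbours of `u` and all neighbours of `v`. -/
def broomSet [Fintype W] [DecidableEq W] (T : W → W → Bool) {u v : W}
    (p : (underG T).Walk u v) : Finset W :=
  p.support.toFinset ∪ (outNbr T u ∪ inNbr T u) ∪ (outNbr T v ∪ inNbr T v)

/-- `z` lies strictly after `x` and strictly before `y` in clockwise (cyclic) order
on `Fin n`. -/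
def cycBetween {n : ℕ} (x y z : Fin n) : Prop :=
  if x < y then x < z ∧ z < y else x < z ∨ z < y

/-- An arc `pq` of the convex digraph `A` on `Fin n` is good for the antidirected
caterpillar `T` with final vertex `u`, its spine neighbour `v`, and spine with
`plen` edges (so `plen + 1` spine vertices). -/
def GoodArc {n : ℕ} (A : Fin n → Fin n → Bool) (T : W → W → Bool)
    (u v : W) (plen : ℕ) (pq : Fin n × Fin n) : Prop :=
  ∃ f : W → Fin n, Function.Injective f ∧ (∀ x y, T x y → A (f x) (f y)) ∧
    ((T v u = true ∧ (f v, f u) = pq) ∨ (T u v = true ∧ (f u, f v) = pq)) ∧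
    (∀ z : Fin n,
      (plen % 2 = 0 → cycBetween (f u) (f v) z → z ∉ Set.range f) ∧
      (plen % 2 = 1 → z ≠ f u → z ≠ f v → ¬ cycBetween (f u) (f v) z →
        z ∉ Set.range f))

/-- Number of edges of a bipartite graph with parts `α`, `β`. -/
def bipArcCount {α β : Type*} [Fintype α] [Fintype β] (E : α → β → Bool) : ℕ :=
  ((univ : Finset (α × β)).filter (fun p => E p.1 p.2)).card

/-- Degree of a vertex of the `α` part. -/
def bipDegA {α β : Type*} [Fintype β] (E : α → β → Bool) (a : α) : ℕ :=
  (univ.filter (fun b => E a b)).card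

/-- Degree of a vertex of the `β` part. -/
def bipDegB {α β : Type*} [Fintype α] (E : α → β → Bool) (b : β) : ℕ :=
  (univ.filter (fun a => E a b)).card

end Defs

section CyclicGrowth

variable {V W : Type*}

/-- `d x y` behaves like the clockwise distance from `x` to `y` on a circle. -/
structure IsClockwiseDist (d : V → V → ℕ) : Prop where
  left_inj : ∀ x y z, d x z = d y z → x = y
  right_inj : ∀ x y z, d z x = d z y → x = y
  lt_iff : ∀ p q z, p ≠ q → z ≠ p → z ≠ q → (d z q < d p q ↔ d p z < d p q)

theorem IsClockwiseDist.flip {d : V → V → ℕ} (hd : IsClockwiseDist d) :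
    IsClockwiseDist (fun x y => d y x) where
  left_inj := hd.right_inj
  right_inj := hd.left_inj
  lt_iff p q z hpq hp hq := (hd.lt_iff q p z hpq.symm hq hp).symm

theorem exists_isClockwiseDist [Fintype V] : ∃ d : V → V → ℕ, IsClockwiseDist d := by
  let g := Fintype.equivFin V
  have hinj : ∀ x y : V, (g x : ℕ) = g y → x = y := fun x y h => g.injective (Fin.ext h)
  have hlt : ∀ x : V, (g x : ℕ) < Fintype.card V := fun x => (g x).isLt
  refine ⟨fun x y => if (g x : ℕ) ≤ g y then (g y : ℕ) - g x
    else Fintype.card V + g y - g x, ?_, ?_, ?_⟩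
  · intro x y z h
    have := hlt x; have := hlt y; have := hlt z
    apply hinj
    split_ifs at h <;> omega
  · intro x y z h
    have := hlt x; have := hlt y; have := hlt z
    apply hinj
    split_ifs at h <;> omega
  · intro p q z hpq hp hq
    have := hlt p; have := hlt q; have := hlt z
    have : (g p : ℕ) ≠ g q := fun h => hpq (hinj _ _ h)
    have : (g z : ℕ) ≠ g p := fun h => hp (hinj _ _ h)
    have : (g z : ℕ) ≠ g q := fun h => hq (hinj _ _ h)
    split_ifs <;> omega

/-- Removing from each row of `L` the entry of largest distance costs at most one entry per row,
and every remaining entry is dominated by another entry of `L` in its row. -/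
theorem exists_subset_forall_exists_lt [Fintype V] [DecidableEq V] {d : V → V → ℕ}
    (hd : IsClockwiseDist d) (L : Finset (V × V)) :
    ∃ L' ⊆ L, L.card ≤ L'.card + Fintype.card V ∧
      ∀ a ∈ L', ∃ b ∈ L, b.1 = a.1 ∧ d a.2 a.1 < d b.2 a.1 := by
  refine ⟨L.filter (fun a => ∃ b ∈ L, b.1 = a.1 ∧ d a.2 a.1 < d b.2 a.1),
    filter_subset _ _, ?_, fun a ha => (mem_filter.1 ha).2⟩
  rw [← card_filter_add_card_filter_not (s := L)
    (fun a => ∃ b ∈ L, b.1 = a.1 ∧ d a.2 a.1 < d b.2 a.1)]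
  gcongr
  refine card_le_card_of_injOn Prod.fst (fun _ _ => mem_univ _) ?_
  rintro ⟨q, p⟩ ha ⟨q', p'⟩ hb hab
  simp only [coe_filter, Set.mem_ofPred_eq, not_exists, not_and, not_lt] at ha hb hab
  subst hab
  rw [hd.left_inj p p' q (le_antisymm (hb.2 _ ha.1 rfl) (ha.2 _ hb.1 rfl))]

/-- The subtree of `T` on `S` has copies in `G`, inside every cyclic arrangement of the vertices
of `G`, whose last edge `xy` sits at many arcs of `G`, with no other vertex of the copy strictly
between the ends of that arc. -/
def HasManyCopies [Fintype V] (G : SimpleGraph V) [DecidableRel G.Adj] [Fintype W]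
    (T : SimpleGraph W) [DecidableRel T.Adj] [DecidableEq V] [DecidableEq W]
    (S : Finset W) (x y : W) : Prop :=
  ∃ H : Finset (Sym2 W), H ⊆ T.edgeFinset ∧ (∀ e ∈ H, ∀ v ∈ e, v ∈ S) ∧
    H.card + 1 = S.card ∧ s(x, y) ∈ H ∧
    ∀ d : V → V → ℕ, IsClockwiseDist d → ∃ L : Finset (V × V),
      2 * G.edgeFinset.card + 2 * Fintype.card V ≤ L.card + S.card * Fintype.card V ∧
      ∀ a ∈ L, ∃ f : W → V, Set.InjOn f S ∧ (∀ u v, s(u, v) ∈ H → G.Adj (f u) (f v)) ∧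
        f x = a.1 ∧ f y = a.2 ∧ ∀ w ∈ S, w = x ∨ d a.2 a.1 ≤ d (f w) a.1

variable [Fintype V] [DecidableEq V] {G : SimpleGraph V} [DecidableRel G.Adj]
  [Fintype W] [DecidableEq W] {T : SimpleGraph W} [DecidableRel T.Adj]

theorem hasManyCopies_pair {x y : W} (hxy : T.Adj x y) : HasManyCopies G T {x, y} x y := by
  have hne := hxy.ne
  refine ⟨{s(x, y)}, by simpa using hxy, by simp, by simp [card_pair hne], by simp,
    fun d _ => ⟨univ.filter (fun p : V × V => G.Adj p.1 p.2), ?_, ?_⟩⟩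
  · rw [card_pair hne, SimpleGraph.two_mul_card_edgeFinset]
  · intro a ha
    have ha : G.Adj a.1 a.2 := by simpa using ha
    refine ⟨fun w => if w = x then a.1 else a.2, ?_, ?_, by simp, by simp [hne.symm], ?_⟩
    · have := ha.ne
      intro u hu v hv huv
      simp only [coe_insert, coe_singleton, Set.mem_insert_iff, Set.mem_singleton_iff] at hu hv
      grind
    · intro u v huv
      simp only [mem_singleton, Sym2.eq_iff] at huv
      rcases huv with ⟨rfl, rfl⟩ | ⟨rfl, rfl⟩
      · simpa [hne.symm] using ha
      · simpa [hne.symm] using ha.symm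
    · intro w hw
      by_cases h : w = x
      · exact .inl h
      · simp [h]

theorem HasManyCopies.swap {S : Finset W} {x y : W} (h : HasManyCopies G T S x y) :
    HasManyCopies G T S y x := by
  obtain ⟨H, hHT, hHS, hcard, hxy, h⟩ := h
  refine ⟨H, hHT, hHS, hcard, Sym2.eq_swap ▸ hxy, fun d hd => ?_⟩
  obtain ⟨L, hL, hf⟩ := h _ hd.flip
  refine ⟨L.map (Equiv.prodComm V V).toEmbedding, by simpa using hL, ?_⟩
  rintro ⟨p, q⟩ ha
  have ha : (q, p) ∈ L := by simpa using ha
  obtain ⟨f, hinj, hadj, rfl, rfl, hout⟩ := hf _ ha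
  refine ⟨f, hinj, hadj, rfl, rfl, fun w hw => ?_⟩
  have hx := hHS _ hxy x (by simp)
  have hy := hHS _ hxy y (by simp)
  by_cases hwy : w = y
  · exact .inl hwy
  right
  rcases hout w hw with rfl | hle
  · exact le_rfl
  · dsimp only at hle ⊢
    by_cases hwx : w = x
    · rw [hwx]
    · have := hd.lt_iff (f x) (f y) (f w) (hadj _ _ hxy).ne
        (fun h => hwx (hinj hw hx h)) (fun h => hwy (hinj hw hy h))
      omega

theorem HasManyCopies.insert {S : Finset W} {x y c : W} (h : HasManyCopies G T S x y)
    (hc : c ∉ S) (hxc : T.Adj x c) : HasManyCopies G T (insert c S) x c := by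
  obtain ⟨H, hHT, hHS, hcard, hxy, h⟩ := h
  have hx := hHS _ hxy x (by simp)
  have hy := hHS _ hxy y (by simp)
  have hnew : s(x, c) ∉ H := fun h => hc (hHS _ h c (by simp))
  refine ⟨Insert.insert s(x, c) H, ?_, ?_, ?_, mem_insert_self _ _, fun d hd => ?_⟩
  · exact insert_subset (by simpa using hxc) hHT
  · intro e he v hv
    rcases mem_insert.1 he with rfl | he
    · rcases Sym2.mem_iff.1 hv with rfl | rfl <;> simp [hx]
    · exact mem_insert_of_mem (hHS e he v hv)
  · rw [card_insert_of_notMem hnew, card_insert_of_notMem hc, hcard]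
  obtain ⟨L, hL, hf⟩ := h d hd
  obtain ⟨L', hL'L, hL', hlt⟩ := exists_subset_forall_exists_lt hd L
  refine ⟨L', by rw [card_insert_of_notMem hc, add_mul]; omega, fun a ha => ?_⟩
  obtain ⟨b, hb, hba, hdist⟩ := hlt a ha
  have hadja : G.Adj a.1 a.2 := by
    obtain ⟨g, -, hg, hgx, hgy, -⟩ := hf a (hL'L ha)
    rw [← hgx, ← hgy]
    exact hg _ _ hxy
  obtain ⟨f, hinj, hadj, hfx, hfy, hout⟩ := hf b hb
  rw [hba] at hfx hout
  have hfresh : ∀ w ∈ S, f w ≠ a.2 := by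
    intro w hw hwa
    rcases hout w hw with rfl | hle
    · exact hadja.ne (hfx.symm.trans hwa)
    · rw [hwa] at hle
      omega
  have hupd : ∀ w ∈ S, Function.update f c a.2 w = f w := fun w hw =>
    Function.update_of_ne (ne_of_mem_of_not_mem hw hc) _ _
  refine ⟨Function.update f c a.2, ?_, ?_, by rw [hupd x hx, hfx], by simp, ?_⟩
  · rw [coe_insert, Set.injOn_insert (by simpa using hc)]
    refine ⟨hinj.congr fun w hw => (hupd w hw).symm, ?_⟩
    rintro ⟨w, hw, hwc⟩
    rw [hupd w hw, Function.update_self] at hwc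
    exact hfresh w hw hwc
  · intro u v huv
    rcases mem_insert.1 huv with huv | huv
    · rcases Sym2.eq_iff.1 huv with ⟨rfl, rfl⟩ | ⟨rfl, rfl⟩
      · rw [hupd u hx, Function.update_self, hfx]
        exact hadja
      · rw [hupd v hx, Function.update_self, hfx]
        exact hadja.symm
    · rw [hupd u (hHS _ huv u (by simp)), hupd v (hHS _ huv v (by simp))]
      exact hadj u v huv
  · intro w hw
    rcases mem_insert.1 hw with rfl | hw
    · simp
    · rw [hupd w hw]
      exact (hout w hw).imp_right fun hle => hdist.le.trans hle

theorem HasManyCopies.union {S : Finset W} {x y : W} (h : HasManyCopies G T S x y)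
    (N : Finset W) (hN : ∀ c ∈ N, T.Adj x c) : ∃ z, HasManyCopies G T (S ∪ N) x z := by
  induction N using Finset.induction_on with
  | empty => exact ⟨y, by simpa using h⟩
  | insert c N _ ih =>
    obtain ⟨z, hz⟩ := ih fun c hc => hN c (mem_insert_of_mem hc)
    rw [union_insert]
    by_cases hc : c ∈ S ∪ N
    · exact ⟨z, by rwa [insert_eq_of_mem hc]⟩
    · exact ⟨c, hz.insert hc (hN c (mem_insert_self _ _))⟩

theorem HasManyCopies.exists_univ {x t : W} (P : T.Walk x t) (hP : P.IsPath) {S : Finset W}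
    {y : W} (h : HasManyCopies G T S x y) (hx : x ∈ S) (hPS : ∀ v ∈ P.support, v ∈ S → v = x)
    (hcov : ∀ v, v ∉ S → v ∈ P.support ∨ ∃ w ∈ P.support, T.Adj v w) :
    ∃ x y, HasManyCopies G T univ x y := by
  induction P generalizing S y with
  | @nil x =>
    obtain ⟨z, hz⟩ := h.union (T.neighborFinset x) (by simp)
    refine ⟨x, z, ?_⟩
    convert hz
    refine (eq_univ_of_forall fun v => ?_).symm
    by_cases hv : v ∈ S
    · simp [hv]
    · have := hcov v hv
      simp only [SimpleGraph.Walk.support_nil, List.mem_singleton, exists_eq_left] at this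
      rcases this with rfl | hvx
      · exact absurd hx hv
      · simp [hvx.symm]
  | @cons x x' t hxx' P ih =>
    rw [SimpleGraph.Walk.cons_isPath_iff] at hP
    simp only [SimpleGraph.Walk.support_cons, List.mem_cons] at hPS hcov
    have hxP := hP.2
    have hx'P := P.start_mem_support
    obtain ⟨z, hz⟩ := h.union ((T.neighborFinset x).filter (· ∉ P.support))
      (fun c hc => by simpa using (mem_filter.1 hc).1)
    have hx'S : x' ∉ S := fun hS => hxx'.ne (hPS x' (.inr hx'P) hS).symm
    refine ih hP.1 (hz.insert (by simp [hx'S]) hxx').swap (mem_insert_self _ _) ?_ ?_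
    · intro v hv hvS
      simp only [mem_insert, mem_union, mem_filter] at hvS
      rcases hvS with rfl | hvS | hvS
      · rfl
      · rw [hPS v (.inr hv) hvS] at hv
        exact absurd hv hxP
      · exact absurd hv hvS.2
    · intro v hv
      simp only [mem_insert, mem_union, mem_filter, SimpleGraph.mem_neighborFinset] at hv
      push Not at hv
      rcases hcov v hv.2.1 with (rfl | hvP) | ⟨w, rfl | hw, hvw⟩
      · exact absurd hx hv.2.1
      · exact .inl hvP
      · exact .inl (hv.2.2 hvw.symm)
      · exact .inr ⟨w, hw, hvw⟩

theorem IsCaterpillarG.exists_hasManyCopies_univ [Nontrivial W] (hT : IsCaterpillarG T) :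
    ∃ x y, HasManyCopies G T univ x y := by
  obtain ⟨-, x, t, P, hP, hcov⟩ := hT
  by_cases hy : ∃ y, y ∉ P.support ∧ T.Adj x y
  · obtain ⟨y, hyP, hxy⟩ := hy
    refine (hasManyCopies_pair hxy).exists_univ P hP (by simp) ?_ fun v _ => hcov v
    intro v hv hvS
    rcases mem_insert.1 hvS with rfl | hvS
    · rfl
    · rw [mem_singleton.1 hvS] at hv
      exact absurd hv hyP
  · push Not at hy
    cases P with
    | nil =>
      obtain ⟨w, hw⟩ := exists_ne x
      rcases hcov w with hwP | ⟨v, hv, hwv⟩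
      · exact absurd (by simpa using hwP) hw
      · obtain rfl : v = x := by simpa using hv
        exact absurd hwv.symm (hy w (by simpa using hw))
    | @cons _ x' _ hxx' P =>
      rw [SimpleGraph.Walk.cons_isPath_iff] at hP
      simp only [SimpleGraph.Walk.support_cons, List.mem_cons] at hcov hy
      refine (hasManyCopies_pair hxx').swap.exists_univ P hP.1 (by simp) ?_ ?_
      · intro v hv hvS
        rcases mem_insert.1 hvS with rfl | hvS
        · exact absurd hv hP.2
        · exact mem_singleton.1 hvS
      · intro v hv
        simp only [mem_insert, mem_singleton, not_or] at hv
        rcases hcov v with (rfl | hvP) | ⟨w, rfl | hw, hvw⟩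
        · exact absurd rfl hv.1
        · exact .inl hvP
        · by_contra hcon
          push Not at hcon
          exact hy v (not_or.2 ⟨hv.1, hcon.1⟩) hvw.symm
        · exact .inr ⟨w, hw, hvw⟩

end CyclicGrowth

/-- Every graph on `n` vertices with more than `(k−1)·n/2` edges contains
every caterpillar with `k` edges as a subgraph. -/
theorem stmt_2 (k : ℕ) (hk : 0 < k)
    {V : Type*} [Fintype V] [DecidableEq V]
    (G : SimpleGraph V) [DecidableRel G.Adj]
    (hG : (k - 1) * Fintype.card V < 2 * G.edgeFinset.card)
    {W : Type*} [Fintype W] [DecidableEq W]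
    (T : SimpleGraph W) [DecidableRel T.Adj]
    (hcat : IsCaterpillarG T) (hkT : T.edgeFinset.card = k) :
    ∃ f : W → V, Function.Injective f ∧ ∀ x y, T.Adj x y → G.Adj (f x) (f y) := by
  have hW : k + 1 = Fintype.card W := hkT ▸ hcat.1.card_edgeFinset
  have : Nontrivial W := Fintype.one_lt_card_iff_nontrivial.1 (by omega)
  obtain ⟨x, y, H, hHT, -, hcard, -, h⟩ := hcat.exists_hasManyCopies_univ (G := G)
  have hH : H = T.edgeFinset := eq_of_subset_of_card_le hHT (by
    rw [card_univ] at hcard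
    omega)
  obtain ⟨d, hd⟩ := exists_isClockwiseDist (V := V)
  obtain ⟨L, hL, hf⟩ := h d hd
  have hpos : 0 < L.card := by
    obtain ⟨m, rfl⟩ := Nat.exists_eq_add_of_lt hk
    rw [card_univ, ← hW] at hL
    simp only [zero_add, Nat.add_sub_cancel] at hG hL
    linarith
  obtain ⟨a, ha⟩ := card_pos.1 hpos
  obtain ⟨f, hinj, hadj, -⟩ := hf a ha
  refine ⟨f, by simpa using hinj, fun u v huv => hadj u v ?_⟩
  rw [hH]
  simpa using huv
end

section
/- Let k be a positive integer, set s = ⌈k/12⌉, let T be an antidirected tree with k arcs, and let D be a 𝒦_{2,s}-free digraph with n vertices and more than (k−1)·n arcs. If Δ₂(T) ≤ ⌊k/4⌋ + 2, then T embeds in D. -/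
open Finset

set_option linter.unusedSectionVars false

theorem card_union_union_add_card_le {V : Type*} [DecidableEq V] (Q X Y : Finset V) :
    #(Q ∪ X ∪ Y) + #Q ≤ #(Q ∪ X) + #(Q ∪ Y) := by
  have h := card_union_add_card_inter (Q ∪ X) (Q ∪ Y)
  have h1 : #Q ≤ #((Q ∪ X) ∩ (Q ∪ Y)) := card_le_card (by grind)
  have h2 : #(Q ∪ X ∪ Y) ≤ #((Q ∪ X) ∪ (Q ∪ Y)) := card_le_card (by grind)
  omega

/-- A new vertex can be mapped into the set `F p` of images available at its parent `p` so that the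
demands `d` of the vertices in `A` and the demand `m` of the new vertex can still be met by the
available images, singly and in pairs. -/
theorem exists_candidate {W V : Type*} [DecidableEq W] [DecidableEq V]
    (A : Finset W) (p : W) (hp : p ∈ A) (F : W → Finset V) (E : V → Finset V)
    (d : W → ℕ) (m R K K' : ℕ)
    (hE : ∀ w ∈ F p, w ∉ E w) (ρ : W → ℕ) (hρ : ∀ x ∈ A, x ≠ p → ρ x = d x)
    (hρp : d p + 1 ≤ ρ p) (hρ2 : 2 ≤ ρ p) (h1' : ∀ x ∈ A, ρ x ≤ #(F x))
    (h2' : ∀ x ∈ A, ∀ y ∈ A, x ≠ y → ρ x + ρ y ≤ #(F x ∪ F y))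
    (hAAA : ∀ x ∈ A, ∀ y ∈ A, ∀ z ∈ A, x ≠ y → x ≠ z → y ≠ z → K ≤ #(F x ∪ F y ∪ F z))
    (hAAC : ∀ x ∈ A, ∀ y ∈ A, ∀ w ∈ F p, x ≠ y → K ≤ #(F x ∪ F y ∪ E w))
    (hACC : ∀ x ∈ A, ∀ w ∈ F p, ∀ w' ∈ F p, w ≠ w' → K ≤ #(F x ∪ E w ∪ E w'))
    (hCCC : ∀ w ∈ F p, ∀ w' ∈ F p, ∀ w'' ∈ F p, w ≠ w' → w ≠ w'' → w' ≠ w'' →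
      K ≤ #(E w ∪ E w' ∪ E w''))
    (hAACC : ∀ x ∈ A, ∀ y ∈ A, ∀ w ∈ F p, ∀ w' ∈ F p, x ≠ y → w ≠ w' →
      K' ≤ #(F x ∪ F y ∪ (E w ∪ E w')))
    (hd : ∀ X ⊆ A, ∑ x ∈ X, d x + m + 1 ≤ R) (hK : R + 1 ≤ K)
    (hstar : ∀ x ∈ A, d x + 2 * m ≤ K) (hm2 : 2 * m < K) (hm3 : 3 * m < K + 3)
    (hK' : m + R ≤ K') :
    ∃ w ∈ F p, m ≤ #(E w) ∧ (∀ x ∈ A, d x ≤ #((F x).erase w)) ∧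
      (∀ x ∈ A, ∀ y ∈ A, x ≠ y → d x + d y ≤ #((F x ∪ F y).erase w)) ∧
      ∀ x ∈ A, m + d x ≤ #((E w ∪ F x).erase w) := by
  have h1 : ∀ x ∈ A, d x + (if x = p then 1 else 0) ≤ #(F x) := by
    intro x hx
    have := h1' x hx
    split_ifs with h
    · subst h; omega
    · rw [hρ x hx h] at this; omega
  have h2 : ∀ x ∈ A, ∀ y ∈ A, x ≠ y →
      d x + d y + (if x = p ∨ y = p then 1 else 0) ≤ #(F x ∪ F y) := by
    intro x hx y hy hxy
    have := h2' x hx y hy hxy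
    by_cases hxp : x = p
    · subst hxp; rw [hρ y hy hxy.symm] at this; simp only [true_or, if_true]; omega
    · rw [hρ x hx hxp] at this
      by_cases hyp : y = p
      · subst hyp; simp only [or_true, if_true]; omega
      · rw [hρ y hy hyp] at this; simp only [hxp, hyp, or_self, if_false]; omega
  have hFp : 2 ≤ #(F p) := hρ2.trans (h1' p hp)
  have hd2 : ∀ x ∈ A, ∀ y ∈ A, x ≠ y → d x + d y + m + 1 ≤ R := by
    intro x hx y hy hxy
    have := hd {x, y} (by simp [insert_subset_iff, *])
    rwa [sum_pair hxy] at this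
  have hd3 : ∀ x ∈ A, ∀ y ∈ A, ∀ z ∈ A, x ≠ y → x ≠ z → y ≠ z →
      d x + d y + d z + m + 1 ≤ R := by
    intro x hx y hy z hz hxy hxz hyz
    have := hd {x, y, z} (by simp [insert_subset_iff, *])
    rw [sum_insert (by simp [*]), sum_pair hyz] at this
    omega
  have hd4 : ∀ x ∈ A, ∀ y ∈ A, ∀ z ∈ A, ∀ t ∈ A, x ≠ y → x ≠ z → x ≠ t → y ≠ z → y ≠ t →
      z ≠ t → d x + d y + d z + d t + m + 1 ≤ R := by
    intro x hx y hy z hz t ht hxy hxz hxt hyz hyt hzt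
    have := hd {x, y, z, t} (by simp [insert_subset_iff, *])
    rw [sum_insert (by simp [*]), sum_insert (by simp [*]), sum_pair hzt] at this
    omega
  have herase : ∀ (X : Finset V) (w : V) (a : ℕ), a + 1 ≤ #X → a ≤ #(X.erase w) := by
    intro X w a h
    have := pred_card_le_card_erase (s := X) (a := w)
    omega
  by_cases hcp : ∃ q ∈ A, ∃ q' ∈ A, q ≠ q' ∧ q ≠ p ∧ q' ≠ p ∧ #(F q ∪ F q') ≤ d q + d q'
  · obtain ⟨q, hq, q', hq', hqq, hqp, hq'p, hcrit⟩ := hcp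
    have hlow : ∀ Z : Finset V, ∀ a, K ≤ #(F q ∪ F q' ∪ Z) → d q + d q' + a ≤ R + 1 →
        a ≤ #(Z \ (F q ∪ F q')) := by
      intro Z a h h'
      rw [← union_sdiff_self_eq_union, card_union_of_disjoint disjoint_sdiff] at h
      omega
    have hlow' : ∀ Z Z' : Finset V, ∀ a, K ≤ #(F q ∪ F q' ∪ Z) → d q + d q' + a ≤ R + 1 →
        Z ⊆ Z' → a ≤ #Z' := fun Z Z' a h h' hZ =>
      (hlow Z a h h').trans (card_le_card (sdiff_subset.trans hZ))
    have hmix : ∀ Z : Finset V, ∀ a, K ≤ #(F q ∪ F q' ∪ Z) → d q + d q' + a ≤ R + 1 →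
        (d q + a ≤ #(F q ∪ Z) ∧ d q' + a ≤ #(F q' ∪ Z)) := by
      intro Z a h h'
      have ha := hlow Z a h h'
      have e1 := h1 q hq
      have e2 := h1 q' hq'
      constructor
      · have : #(F q ∪ (Z \ (F q ∪ F q'))) ≤ #(F q ∪ Z) :=
          card_le_card (union_subset_union_right sdiff_subset)
        rw [card_union_of_disjoint (disjoint_sdiff.mono_left subset_union_left)] at this
        omega
      · have : #(F q' ∪ (Z \ (F q ∪ F q'))) ≤ #(F q' ∪ Z) :=
          card_le_card (union_subset_union_right sdiff_subset)
        rw [card_union_of_disjoint (disjoint_sdiff.mono_left subset_union_right)] at this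
        omega
    have hA3 : ∀ x ∈ A, x ≠ q → x ≠ q' → K ≤ #(F q ∪ F q' ∪ F x) := fun x hx h h' =>
      hAAA q hq q' hq' x hx hqq h.symm h'.symm
    have hne : 1 ≤ #(F p \ (F q ∪ F q')) :=
      hlow _ _ (hA3 p hp hqp.symm hq'p.symm) (by have := hd2 q hq q' hq' hqq; omega)
    obtain ⟨w, hw⟩ := card_pos.1 hne
    rw [mem_sdiff, mem_union, not_or] at hw
    obtain ⟨hwp, hwq, hwq'⟩ := hw
    have hEw := hAAC q hq q' hq' w hwp hqq
    have hwE := hE w hwp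
    refine ⟨w, hwp, hlow' _ _ _ hEw (by have := hd2 q hq q' hq' hqq; omega) Subset.rfl,
      ?_, ?_, ?_⟩
    · intro x hx
      by_cases hxq : x = q
      · subst hxq; rw [erase_eq_of_notMem hwq]; have := h1 x hx; omega
      by_cases hxq' : x = q'
      · subst hxq'; rw [erase_eq_of_notMem hwq']; have := h1 x hx; omega
      apply herase
      exact hlow' _ _ _ (hA3 x hx hxq hxq')
        (by have := hd3 q hq q' hq' x hx hqq (Ne.symm hxq) (Ne.symm hxq'); omega) Subset.rfl
    · have key : ∀ x ∈ A, ∀ y ∈ A, x ≠ y → y ≠ q → y ≠ q' →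
          d x + d y ≤ #((F x ∪ F y).erase w) := by
        intro x hx y hy hxy hyq hyq'
        apply herase
        have h3 := hd3 q hq q' hq' y hy hqq (Ne.symm hyq) (Ne.symm hyq')
        have hb := hmix (F y) (d y + 1) (hA3 y hy hyq hyq') (by omega)
        by_cases hxq : x = q
        · subst hxq; omega
        by_cases hxq' : x = q'
        · subst hxq'; omega
        have h4 := hd4 q hq q' hq' x hx y hy hqq (Ne.symm hxq) (Ne.symm hyq) (Ne.symm hxq')
          (Ne.symm hyq') hxy
        exact hlow' (F x ∪ F y) _ _
          ((hA3 y hy hyq hyq').trans (card_le_card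
            (union_subset_union_right subset_union_right))) (by omega) Subset.rfl
      intro x hx y hy hxy
      by_cases hy' : y ≠ q ∧ y ≠ q'
      · exact key x hx y hy hxy hy'.1 hy'.2
      by_cases hx' : x ≠ q ∧ x ≠ q'
      · rw [union_comm, add_comm]; exact key y hy x hx hxy.symm hx'.1 hx'.2
      · have hxw : w ∉ F x := by
          rcases not_and_or.1 hx' with h | h <;> rw [not_not.1 h] <;> assumption
        have hyw : w ∉ F y := by
          rcases not_and_or.1 hy' with h | h <;> rw [not_not.1 h] <;> assumption
        rw [erase_eq_of_notMem (by simp [hxw, hyw])]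
        have := h2 x hx y hy hxy
        omega
    · intro x hx
      by_cases hxq : x = q
      · subst hxq
        rw [erase_eq_of_notMem (by simp [*]), union_comm, add_comm]
        exact (hmix _ _ hEw (by have := hd2 x hx q' hq' hqq; omega)).1
      by_cases hxq' : x = q'
      · subst hxq'
        rw [erase_eq_of_notMem (by simp [*]), union_comm, add_comm]
        exact (hmix _ _ hEw (by have := hd2 q hq x hx hqq; omega)).2
      apply herase
      exact hlow' (E w ∪ F x) _ _ (hEw.trans (card_le_card
        (union_subset_union_right subset_union_left)))
        (by have := hd3 q hq q' hq' x hx hqq (Ne.symm hxq) (Ne.symm hxq'); omega) Subset.rfl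
  push Not at hcp
  have hold : ∀ w ∈ F p, (∀ q ∈ A, q ≠ p → #(F q) ≤ d q → w ∉ F q) →
      (∀ x ∈ A, d x ≤ #((F x).erase w)) ∧
      (∀ x ∈ A, ∀ y ∈ A, x ≠ y → d x + d y ≤ #((F x ∪ F y).erase w)) := by
    intro w hw hq
    constructor
    · intro x hx
      have := h1 x hx
      by_cases hxp : x = p
      · apply herase; simpa [hxp] using this
      · by_cases hc : #(F x) ≤ d x
        · rw [erase_eq_of_notMem (hq x hx hxp hc)]; omega
        · apply herase; omega
    · intro x hx y hy hxy
      apply herase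
      by_cases hxp : x = p
      · simpa [hxp] using h2 x hx y hy hxy
      by_cases hyp : y = p
      · simpa [hyp] using h2 x hx y hy hxy
      · exact hcp x hx y hy hxy hxp hyp
  have hpair : ∀ w ∈ F p, ∀ x, ¬ m + d x ≤ #((E w ∪ F x).erase w) → #(F x ∪ E w) ≤ m + d x := by
    intro w _ x h
    rw [union_comm]
    by_contra h'
    exact h (herase _ _ _ (by omega))
  by_cases hcs : ∃ q ∈ A, q ≠ p ∧ #(F q) ≤ d q
  · obtain ⟨q, hq, hqp, hcrit⟩ := hcs
    have huniq : ∀ x ∈ A, x ≠ p → #(F x) ≤ d x → x = q := by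
      intro x hx hxp hxc
      by_contra hxq
      have a1 := hcp x hx q hq hxq hxp hqp
      have := card_union_le (F x) (F q)
      omega
    have hC : 2 ≤ #(F p \ F q) := by
      have a1 := h2' p hp q hq (Ne.symm hqp)
      rw [hρ q hq hqp, ← sdiff_union_self_eq_union,
        card_union_of_disjoint sdiff_disjoint] at a1
      omega
    obtain ⟨w₁, hw₁, w₂, hw₂, hne⟩ := one_lt_card.1 hC
    have hgood : ∀ w ∈ F p \ F q, d q + m ≤ #(F q ∪ E w) →
      ∃ w ∈ F p, m ≤ #(E w) ∧ (∀ x ∈ A, d x ≤ #((F x).erase w)) ∧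
      (∀ x ∈ A, ∀ y ∈ A, x ≠ y → d x + d y ≤ #((F x ∪ F y).erase w)) ∧
      ∀ x ∈ A, m + d x ≤ #((E w ∪ F x).erase w) := by
      intro w hw hwq
      rw [mem_sdiff] at hw
      have hcu := card_union_le (F q) (E w)
      have := hold w hw.1 (fun x hx hxp hc => by rw [huniq x hx hxp hc]; exact hw.2)
      refine ⟨w, hw.1, by omega, this.1, this.2, ?_⟩
      intro x hx
      by_cases hxq : x = q
      · subst hxq
        rw [erase_eq_of_notMem (by simp [hE w hw.1, hw.2]), union_comm]; omega
      by_contra hbad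
      have b1 := hpair w hw.1 x hbad
      have b2 := hAAC q hq x hx w hw.1 (Ne.symm hxq)
      have b3 := card_union_le (F q) (F x ∪ E w)
      rw [← union_assoc] at b3
      have b4 := hd2 q hq x hx (Ne.symm hxq)
      omega
    by_cases hg : d q + m ≤ #(F q ∪ E w₁)
    · exact hgood w₁ hw₁ hg
    by_cases hg' : d q + m ≤ #(F q ∪ E w₂)
    · exact hgood w₂ hw₂ hg'
    exfalso
    have b1 := hACC q hq w₁ (mem_sdiff.1 hw₁).1 w₂ (mem_sdiff.1 hw₂).1 hne
    have b2 := card_union_union_add_card_le (F q) (E w₁) (E w₂)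
    have b3 := hstar q hq
    have b4 := h1 q hq
    omega
  · push Not at hcs
    have hF : ∀ x ∈ A, d x + 1 ≤ #(F x) := by
      intro x hx
      by_cases hxp : x = p
      · simpa [hxp] using h1 x hx
      · exact hcs x hx hxp
    by_contra hcon
    push Not at hcon
    have hbad : ∀ w ∈ F p, #(E w) < m ∨ ∃ x ∈ A, #(F x ∪ E w) ≤ m + d x := by
      intro w hw
      by_contra h
      push Not at h
      have ho := hold w hw (fun q hq hqp hc => absurd (hcs q hq hqp) (by omega))
      obtain ⟨x, hx, hlt⟩ := hcon w hw h.1 ho.1 ho.2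
      have := h.2 x hx
      have := hpair w hw x (by omega)
      omega
    have hmixed : ∀ w ∈ F p, ∀ w' ∈ F p, w ≠ w' → #(E w) < m →
        ∀ x ∈ A, ¬ #(F x ∪ E w') ≤ m + d x := by
      intro w hw w' hw' hne hs x hx hb
      have b1 := hACC x hx w' hw' w hw hne.symm
      have b2 := card_union_le (F x ∪ E w') (E w)
      have b3 := hstar x hx
      omega
    obtain ⟨w₁, hw₁, w₂, hw₂, hne⟩ := one_lt_card.1 hFp
    rcases hbad w₁ hw₁ with s₁ | ⟨x, hx, b₁⟩
    · rcases hbad w₂ hw₂ with s₂ | ⟨y, hy, b₂⟩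
      · by_cases h3 : ∃ w₃ ∈ F p, w₃ ≠ w₁ ∧ w₃ ≠ w₂
        · obtain ⟨w₃, hw₃, h31, h32⟩ := h3
          rcases hbad w₃ hw₃ with s₃ | ⟨y, hy, b₃⟩
          · have a1 := hCCC w₁ hw₁ w₂ hw₂ w₃ hw₃ hne h31.symm h32.symm
            have a2 := card_union_le (E w₁ ∪ E w₂) (E w₃)
            have a3 := card_union_le (E w₁) (E w₂)
            omega
          · exact hmixed w₁ hw₁ w₃ hw₃ h31.symm s₁ y hy b₃
        · have hsub : F p ⊆ {w₁, w₂} := by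
            intro w hw
            by_contra hw'
            exact h3 ⟨w, hw, by simpa [not_or] using hw'⟩
          have a0 := (card_le_card hsub).trans card_le_two
          have a1 := hACC p hp w₁ hw₁ w₂ hw₂ hne
          have a2 := card_union_le (F p ∪ E w₁) (E w₂)
          have a3 := card_union_le (F p) (E w₁)
          omega
      · exact hmixed w₁ hw₁ w₂ hw₂ hne s₁ y hy b₂
    · rcases hbad w₂ hw₂ with s₂ | ⟨y, hy, b₂⟩
      · exact hmixed w₂ hw₂ w₁ hw₁ hne.symm s₂ x hx b₁
      · by_cases hxy : x = y
        · subst hxy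
          have a1 := hACC x hx w₁ hw₁ w₂ hw₂ hne
          have a2 := card_union_union_add_card_le (F x) (E w₁) (E w₂)
          have a3 := hstar x hx
          have a4 := hF x hx
          omega
        · have a1 := hAACC x hx y hy w₁ hw₁ w₂ hw₂ hxy hne
          have a2 := card_union_le (F x ∪ E w₁) (F y ∪ E w₂)
          have a3 : #(F x ∪ F y ∪ (E w₁ ∪ E w₂)) ≤ #(F x ∪ E w₁ ∪ (F y ∪ E w₂)) :=
            card_le_card (union_union_union_comm _ _ _ _).subset
          have a4 := hd2 x hx y hy hxy
          omega

/-- A rooted tree on `W`, given by a parent function along which the depth decreases; the parent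
of the root is irrelevant. -/
structure ParentTree (W : Type*) where
  /-- The root. -/
  root : W
  /-- The parent of a vertex. -/
  par : W → W
  /-- A height function. -/
  dep : W → ℕ
  dep_par : ∀ w, w ≠ root → dep (par w) < dep w

namespace ParentTree

variable {W V : Type*} [Fintype W] [DecidableEq W] [DecidableEq V] (τ : ParentTree W)

/-- The children of a vertex. -/
def kids (x : W) : Finset W := univ.filter fun w => w ≠ τ.root ∧ τ.par w = x

/-- The root together with all vertices having a child. -/
def inner : Finset W := univ.filter fun x => x = τ.root ∨ (τ.kids x).Nonempty

/-- `A` contains the root and is closed under taking parents. -/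
def Closed (A : Finset W) : Prop := τ.root ∈ A ∧ ∀ w ∈ A, w ≠ τ.root → τ.par w ∈ A

variable {τ}

theorem mem_kids {x w : W} : w ∈ τ.kids x ↔ w ≠ τ.root ∧ τ.par w = x := by simp [kids]

theorem mem_inner {x : W} : x ∈ τ.inner ↔ x = τ.root ∨ (τ.kids x).Nonempty := by simp [inner]

theorem root_mem_inner : τ.root ∈ τ.inner := by simp [inner]

theorem mem_kids_par {w : W} (hw : w ≠ τ.root) : w ∈ τ.kids (τ.par w) := mem_kids.2 ⟨hw, rfl⟩

theorem par_mem_inner {w : W} (hw : w ≠ τ.root) : τ.par w ∈ τ.inner :=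
  mem_inner.2 (Or.inr ⟨w, mem_kids_par hw⟩)

theorem ne_of_mem_kids {x w : W} (h : w ∈ τ.kids x) : w ≠ x := by
  rintro rfl
  obtain ⟨h1, h2⟩ := mem_kids.1 h
  have := τ.dep_par w h1
  rw [h2] at this
  exact lt_irrefl _ this

theorem closed_inner : τ.Closed τ.inner := ⟨root_mem_inner, fun _ _ hw => par_mem_inner hw⟩

theorem Closed.insert {A : Finset W} (h : τ.Closed A) {y : W} (hy : τ.par y ∈ A) :
    τ.Closed (insert y A) := by
  refine ⟨mem_insert_of_mem h.1, fun w hw hwr => mem_insert_of_mem ?_⟩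
  rcases mem_insert.1 hw with rfl | hw
  · exact hy
  · exact h.2 w hw hwr

theorem Closed.union {A Y : Finset W} (h : τ.Closed A) (hY : ∀ y ∈ Y, τ.par y ∈ A) :
    τ.Closed (A ∪ Y) := by
  refine ⟨mem_union_left _ h.1, fun w hw hwr => mem_union_left _ ?_⟩
  rcases mem_union.1 hw with hw | hw
  · exact h.2 w hw hwr
  · exact hY w hw

theorem closed_root (τ : ParentTree W) : τ.Closed {τ.root} :=
  ⟨mem_singleton_self _, fun _ hw h => absurd (mem_singleton.1 hw) h⟩

theorem Closed.exists_par_mem {A B : Finset W} (hA : τ.Closed A)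
    (hB : τ.Closed B) (h : ¬ B ⊆ A) : ∃ y ∈ B, y ∉ A ∧ τ.par y ∈ A := by
  obtain ⟨z, hzB, hzA⟩ := not_subset.1 h
  obtain ⟨y, hy, hmin⟩ := (B \ A).exists_min_image τ.dep ⟨z, mem_sdiff.2 ⟨hzB, hzA⟩⟩
  obtain ⟨hyB, hyA⟩ := mem_sdiff.1 hy
  have hyr : y ≠ τ.root := fun h => hyA (h ▸ hA.1)
  refine ⟨y, hyB, hyA, ?_⟩
  by_contra hp
  exact absurd (hmin _ (mem_sdiff.2 ⟨hB.2 y hyB hyr, hp⟩)) (not_le.2 (τ.dep_par y hyr))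

theorem sum_card_kids_add_one : ∑ x, #(τ.kids x) + 1 = Fintype.card W := by
  have h : #((univ : Finset W).erase τ.root) = ∑ x, #(τ.kids x) := by
    rw [card_eq_sum_card_fiberwise (f := τ.par) (t := univ) (fun _ _ => mem_coe.2 (mem_univ _))]
    refine sum_congr rfl fun x _ => congrArg card ?_
    ext w
    simp [kids]
  rw [← h, card_erase_of_mem (mem_univ _), card_univ]
  have := Fintype.card_pos_iff.2 ⟨τ.root⟩
  omega

theorem sum_card_kids_add_card_inner_le {X : Finset W} (hX : X ⊆ τ.inner) (hr : τ.root ∈ X) :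
    ∑ x ∈ X, #(τ.kids x) + #τ.inner + 1 ≤ Fintype.card W + #X := by
  have h1 := sum_card_kids_add_one (τ := τ)
  have h2 : ∑ x ∈ X, #(τ.kids x) + ∑ x ∈ τ.inner \ X, #(τ.kids x) ≤ ∑ x, #(τ.kids x) := by
    rw [add_comm, sum_sdiff hX]
    exact sum_le_sum_of_subset (subset_univ _)
  have h3 : #(τ.inner \ X) • 1 ≤ ∑ x ∈ τ.inner \ X, #(τ.kids x) := by
    refine card_nsmul_le_sum _ _ _ fun x hx => ?_
    obtain ⟨hx1, hx2⟩ := mem_sdiff.1 hx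
    rcases mem_inner.1 hx1 with rfl | h
    · exact absurd hr hx2
    · exact card_pos.2 h
  have h4 := card_sdiff_add_card_eq_card hX
  rw [smul_eq_mul, mul_one] at h3
  omega

/-- Number of children of `x` outside `A`, plus one if there are such children and all children of
`x` have children. -/
def demand (τ : ParentTree W) (A : Finset W) (x : W) : ℕ :=
  #(τ.kids x \ A) + if (τ.kids x \ A).Nonempty ∧ τ.kids x ⊆ τ.inner then 1 else 0

theorem sum_demand_le {A X : Finset W} (hA : τ.Closed A) (hX : X ⊆ A) :
    ∑ x ∈ X, τ.demand A x ≤ #(univ \ A) := by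
  classical
  let φ : W → W := fun u => if τ.par u ∈ A then τ.par u else τ.par (τ.par u)
  have h1 : ∑ x ∈ X, #((univ \ A).filter fun u => φ u = x) ≤ #(univ \ A) := by
    rw [← card_biUnion]
    · exact card_le_card (biUnion_subset.2 fun x _ => filter_subset _ _)
    · intro x _ y _ hxy
      exact disjoint_filter.2 fun u _ hu hu' => hxy (hu.symm.trans hu')
  refine (sum_le_sum fun x hx => ?_).trans h1
  have hxA := hX hx
  have hsub : τ.kids x \ A ⊆ (univ \ A).filter fun u => φ u = x := by
    intro u hu
    rw [mem_sdiff, mem_kids] at hu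
    simp [φ, hu.1.2, hu.2, hxA]
  unfold demand
  split_ifs with hc
  · obtain ⟨⟨y, hy⟩, hin⟩ := hc
    rw [mem_sdiff] at hy
    have hyk := mem_kids.1 hy.1
    rcases mem_inner.1 (hin hy.1) with h | ⟨u, hu⟩
    · exact absurd h hyk.1
    have huk := mem_kids.1 hu
    have huA : u ∉ A := fun h => hy.2 (huk.2 ▸ hA.2 u h huk.1)
    have hu1 : u ∉ τ.kids x \ A := by
      intro h
      have := (mem_kids.1 (mem_sdiff.1 h).1).2
      rw [huk.2] at this
      exact hy.2 (this ▸ hxA)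
    rw [← card_insert_of_notMem hu1]
    refine card_le_card (insert_subset ?_ hsub)
    simp [φ, huA, huk.2, hy.2, hyk.2]
  · exact card_le_card hsub

theorem demand_insert_of_ne {A : Finset W} {x y : W} (h : x ≠ τ.par y) :
    τ.demand (insert y A) x = τ.demand A x := by
  have : τ.kids x \ insert y A = τ.kids x \ A := by
    ext w
    simp only [mem_sdiff, mem_insert, mem_kids]
    grind
  simp [demand, this]

theorem demand_insert_par {A : Finset W} {y : W} (hy : y ∉ A) (hyr : y ≠ τ.root) :
    τ.demand (insert y A) (τ.par y) + 1 ≤ τ.demand A (τ.par y) := by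
  have h1 : τ.kids (τ.par y) \ insert y A = (τ.kids (τ.par y) \ A).erase y := by
    ext w
    simp only [mem_sdiff, mem_insert, mem_kids, mem_erase]
    tauto
  have h2 : y ∈ τ.kids (τ.par y) \ A := mem_sdiff.2 ⟨mem_kids_par hyr, hy⟩
  have h3 := card_erase_add_one h2
  simp only [demand, h1]
  split_ifs with a b b
  · omega
  · exact absurd ⟨⟨y, h2⟩, a.2⟩ b
  · omega
  · omega

theorem two_le_demand {A : Finset W} {y : W} (hy : y ∉ A) (hyr : y ≠ τ.root)
    (hyi : y ∈ τ.inner) (hA : A ⊆ τ.inner) : 2 ≤ τ.demand A (τ.par y) := by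
  have h2 : y ∈ τ.kids (τ.par y) \ A := mem_sdiff.2 ⟨mem_kids_par hyr, hy⟩
  by_cases h : τ.kids (τ.par y) ⊆ τ.inner
  · have := card_pos.2 ⟨y, h2⟩
    simp only [demand, h, and_true, if_pos (show (τ.kids (τ.par y) \ A).Nonempty from ⟨y, h2⟩)]
    omega
  · obtain ⟨z, hz, hzi⟩ := not_subset.1 h
    have hzA : z ∈ τ.kids (τ.par y) \ A := mem_sdiff.2 ⟨hz, fun h => hzi (hA h)⟩
    have : 1 < #(τ.kids (τ.par y) \ A) :=
      one_lt_card.2 ⟨y, h2, z, hzA, fun h => hzi (h ▸ hyi)⟩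
    unfold demand
    omega

theorem demand_le {A : Finset W} {x : W} : τ.demand A x ≤ #(τ.kids x) + 1 := by
  have := card_le_card (sdiff_subset (s := τ.kids x) (t := A))
  unfold demand
  split_ifs <;> omega

theorem card_kids_sdiff_le_demand {A : Finset W} {x : W} : #(τ.kids x \ A) ≤ τ.demand A x :=
  Nat.le_add_right _ _

theorem demand_eq_of_subset {A : Finset W} {x : W} (hA : τ.kids x ∩ τ.inner ⊆ A)
    (hA' : A ⊆ τ.inner) : τ.demand A x = #(τ.kids x \ τ.inner) := by
  have h : τ.kids x \ A = τ.kids x \ τ.inner := by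
    ext w
    simp only [mem_sdiff]
    exact ⟨fun h => ⟨h.1, fun h' => h.2 (hA (mem_inter.2 ⟨h.1, h'⟩))⟩,
      fun h => ⟨h.1, fun h' => h.2 (hA' h')⟩⟩
  rw [demand, h, if_neg, add_zero]
  rintro ⟨⟨y, hy⟩, h2⟩
  exact (mem_sdiff.1 hy).2 (h2 (mem_sdiff.1 hy).1)

/-- `f` embeds the closed set `A`, where `M x v` is the set of images allowed for the children of
`x` when `x` is mapped to `v`. -/
structure PEmb (τ : ParentTree W) (M : W → V → Finset V) (A : Finset W) (f : W → V) : Prop where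
  closed : τ.Closed A
  inj : Set.InjOn f A
  mem : ∀ w ∈ A, w ≠ τ.root → f w ∈ M (τ.par w) (f (τ.par w))

/-- Images still available for the children of `x`. -/
def avail (M : W → V → Finset V) (A : Finset W) (f : W → V) (x : W) : Finset V :=
  M x (f x) \ A.image f

variable {M : W → V → Finset V} {A : Finset W} {f : W → V}

theorem PEmb.card_image (h : τ.PEmb M A f) : #(A.image f) = #A := card_image_of_injOn h.inj

theorem pemb_root (M : W → V → Finset V) (u : V) : τ.PEmb M {τ.root} fun _ => u := by
  refine ⟨closed_root τ, ?_, fun w hw h => absurd (mem_singleton.1 hw) h⟩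
  simp

theorem PEmb.extend (h : τ.PEmb M A f) {Y : Finset W} (hY : Disjoint Y A)
    (hp : ∀ w ∈ Y, τ.par w ∈ A) {g : W → V} (hg : ∀ w ∈ Y, g w ∈ avail M A f (τ.par w))
    (hinj : Set.InjOn g Y) : τ.PEmb M (A ∪ Y) (Y.piecewise g f) := by
  have hnot : ∀ w ∈ A, w ∉ Y := fun w hw hw' => disjoint_left.1 hY hw' hw
  have hA : ∀ w ∈ A, Y.piecewise g f w = f w := fun w hw => piecewise_eq_of_notMem _ _ _ (hnot w hw)
  have hYe : ∀ w ∈ Y, Y.piecewise g f w = g w := fun w hw => piecewise_eq_of_mem _ _ _ hw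
  have hne : ∀ a ∈ A, ∀ b ∈ Y, f a ≠ g b := fun a ha b hb hab =>
    (mem_sdiff.1 (hg b hb)).2 (hab ▸ mem_image_of_mem f ha)
  refine ⟨h.closed.union hp, ?_, ?_⟩
  · intro a ha b hb hab
    rcases mem_union.1 (mem_coe.1 ha) with ha | ha <;>
      rcases mem_union.1 (mem_coe.1 hb) with hb | hb
    · rw [hA a ha, hA b hb] at hab; exact h.inj ha hb hab
    · rw [hA a ha, hYe b hb] at hab; exact absurd hab (hne a ha b hb)
    · rw [hYe a ha, hA b hb] at hab; exact absurd hab.symm (hne b hb a ha)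
    · rw [hYe a ha, hYe b hb] at hab; exact hinj ha hb hab
  · intro w hw hwr
    rcases mem_union.1 hw with hw | hw
    · rw [hA w hw, hA _ (h.closed.2 w hw hwr)]; exact h.mem w hw hwr
    · rw [hYe w hw, hA _ (hp w hw)]; exact (mem_sdiff.1 (hg w hw)).1

theorem image_piecewise {Y : Finset W} (hY : Disjoint Y A) (g : W → V) :
    (A ∪ Y).image (Y.piecewise g f) = A.image f ∪ Y.image g := by
  rw [image_union]
  congr 1
  · exact image_congr fun w hw => piecewise_eq_of_notMem _ _ _ fun h => disjoint_left.1 hY h hw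
  · exact image_congr fun w hw => piecewise_eq_of_mem _ _ _ hw

theorem PEmb.extend_one (h : τ.PEmb M A f) {y : W} (hy : y ∉ A) (hp : τ.par y ∈ A) {v : V}
    (hv : v ∈ avail M A f (τ.par y)) : τ.PEmb M (insert y A) (Function.update f y v) := by
  have := h.extend (Y := {y}) (disjoint_singleton_left.2 hy) (by simpa using hp) (g := fun _ => v)
    (by simpa using hv) (by simp)
  rwa [union_singleton, piecewise_singleton] at this

theorem image_update {y : W} (hy : y ∉ A) (v : V) :
    (insert y A).image (Function.update f y v) = insert v (A.image f) := by
  have := image_piecewise (f := f) (disjoint_singleton_left.2 hy) (fun _ => v)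
  rwa [union_singleton, piecewise_singleton, image_singleton, union_singleton] at this

/-- Hall's theorem, used to place all remaining vertices at once. -/
theorem PEmb.exists_univ [Finite V] (h : τ.PEmb M A f) (hp : ∀ w, w ∉ A → τ.par w ∈ A)
    (hall : ∀ X ⊆ A, ∑ x ∈ X, #(τ.kids x \ A) ≤ #(X.biUnion (avail M A f))) :
    ∃ g, τ.PEmb M univ g := by
  have key := (all_card_le_biUnion_card_iff_exists_injective
    (fun w : {w // w ∉ A} => avail M A f (τ.par w))).1 fun s => by
      have h1 := hall (s.image fun w : {w // w ∉ A} => τ.par w) (by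
        intro x hx
        obtain ⟨w, _, rfl⟩ := mem_image.1 hx
        exact hp w w.2)
      rw [image_biUnion] at h1
      refine le_trans ?_ h1
      rw [card_eq_sum_card_image (fun w : {w // w ∉ A} => τ.par w)]
      refine sum_le_sum fun x _ => ?_
      rw [← card_map (Function.Embedding.subtype _)]
      refine card_le_card fun w hw => ?_
      obtain ⟨w, hw', rfl⟩ := mem_map.1 hw
      have hr : (w : W) ≠ τ.root := fun hr => w.2 (hr ▸ h.closed.1)
      exact mem_sdiff.2 ⟨mem_kids.2 ⟨hr, (mem_filter.1 hw').2⟩, w.2⟩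
  obtain ⟨g, hg, hg'⟩ := key
  classical
  have := h.extend (Y := univ \ A) sdiff_disjoint (fun w hw => hp w (mem_sdiff.1 hw).2)
    (g := fun w => if hw : w ∉ A then g ⟨w, hw⟩ else f w)
    (fun w hw => by
      have hw' := (mem_sdiff.1 hw).2
      simpa [hw'] using hg' ⟨w, hw'⟩)
    (fun a ha b hb hab => by
      have ha' := (mem_sdiff.1 (mem_coe.1 ha)).2
      have hb' := (mem_sdiff.1 (mem_coe.1 hb)).2
      simp only [ha', hb', not_false_eq_true, dif_pos] at hab
      exact congrArg Subtype.val (hg hab))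
  rw [union_sdiff_of_subset (subset_univ _)] at this
  exact ⟨_, this⟩

end ParentTree

section

variable {V : Type*} [DecidableEq V] {X Y Z T : Finset V} {δ c : ℕ}

theorem two_mul_le_card_union (hX : δ ≤ #X) (hY : δ ≤ #Y) (hXY : #(X ∩ Y) ≤ c) :
    2 * δ ≤ #(X ∪ Y) + c := by
  have := card_union_add_card_inter X Y
  omega

theorem three_mul_le_card_union (hX : δ ≤ #X) (hY : δ ≤ #Y) (hZ : δ ≤ #Z) (hXY : #(X ∩ Y) ≤ c)
    (hXZ : #(X ∩ Z) ≤ c) (hYZ : #(Y ∩ Z) ≤ c) : 3 * δ ≤ #(X ∪ Y ∪ Z) + 3 * c := by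
  have h1 := two_mul_le_card_union hX hY hXY
  have h2 := card_union_add_card_inter (X ∪ Y) Z
  have h3 : #((X ∪ Y) ∩ Z) ≤ #(X ∩ Z) + #(Y ∩ Z) := by
    rw [union_inter_distrib_right]; exact card_union_le _ _
  omega

theorem four_mul_le_card_union (hX : δ ≤ #X) (hY : δ ≤ #Y) (hZ : δ ≤ #Z) (hT : δ ≤ #T)
    (hXY : #(X ∩ Y) ≤ c) (hXZ : #(X ∩ Z) ≤ c) (hYZ : #(Y ∩ Z) ≤ c) (hXT : #(X ∩ T) ≤ c)
    (hYT : #(Y ∩ T) ≤ c) (hZT : #(Z ∩ T) ≤ c) :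
    4 * δ ≤ #(X ∪ Y ∪ (Z ∪ T)) + 6 * c := by
  have h1 := three_mul_le_card_union hX hY hZ hXY hXZ hYZ
  have h2 := card_union_add_card_inter (X ∪ Y ∪ Z) T
  have h3 : #((X ∪ Y ∪ Z) ∩ T) ≤ #(X ∩ T) + #(Y ∩ T) + #(Z ∩ T) := by
    rw [union_inter_distrib_right, union_inter_distrib_right]
    exact (card_union_le _ _).trans (Nat.add_le_add_right (card_union_le _ _) _)
  rw [← union_assoc]
  omega

end

namespace ParentTree

variable {W V : Type*} [Fintype W] [DecidableEq W] [DecidableEq V] {τ : ParentTree W}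

/-- The branching of the tree: there are `k + 1` vertices, and away from the root the number
of children is small. -/
structure Bounded (τ : ParentTree W) (k c : ℕ) : Prop where
  card : Fintype.card W = k + 1
  c_pos : 0 < c
  c_lt : 12 * c < k
  kids_le : ∀ x, x ≠ τ.root → #(τ.kids x) ≤ k / 4 + 1
  kids_lt : ∀ x, x ≠ τ.root → #(τ.kids x) + 1 ≤ #(τ.kids τ.root)

/-- The vertices of `G x` are good images for `x`: they have large degree, and children can again be
mapped to good vertices. The root is mapped to `u`, and `M₀` consists of good images for the
children of the root. -/
structure Host (τ : ParentTree W) (M : W → V → Finset V) (G : W → Finset V) (M₀ : Finset V)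
    (u : V) (δ c : ℕ) : Prop where
  self : ∀ x v, v ∉ M x v
  inter : ∀ x y v v', v ≠ v' → #(M x v ∩ M y v') ≤ c
  sub_root : M₀ ⊆ M τ.root u
  good_root : ∀ y ∈ τ.kids τ.root, M₀ ⊆ G y
  good : ∀ x, x ≠ τ.root → ∀ v ∈ G x, ∀ y ∈ τ.kids x, M x v ⊆ G y
  deg : ∀ x, x ≠ τ.root → ∀ v ∈ G x, δ ≤ #(M x v)
  le_card : δ ≤ #M₀
  le_card_root : #(τ.kids τ.root) ≤ #(M τ.root u)

/-- A partial embedding into good vertices with enough room around every vertex and every pair of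
vertices. -/
structure Roomy (τ : ParentTree W) (M : W → V → Finset V) (G : W → Finset V) (u : V)
    (A : Finset W) (f : W → V) : Prop extends τ.PEmb M A f where
  sub : A ⊆ τ.inner
  kids_root : τ.kids τ.root ∩ τ.inner ⊆ A
  map_root : f τ.root = u
  good : ∀ x ∈ A, x ≠ τ.root → f x ∈ G x
  one : ∀ x ∈ A, τ.demand A x ≤ #(avail M A f x)
  two : ∀ x ∈ A, ∀ y ∈ A, x ≠ y →
    τ.demand A x + τ.demand A y ≤ #(avail M A f x ∪ avail M A f y)

variable {M : W → V → Finset V} {G : W → Finset V} {M₀ : Finset V} {u : V} {A : Finset W}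
  {f : W → V} {k δ c : ℕ}

theorem Roomy.le_card (h : τ.Roomy M G u A f) (hH : τ.Host M G M₀ u δ c) {x : W} (hx : x ∈ A) :
    δ ≤ #(M x (f x)) := by
  by_cases hxr : x = τ.root
  · subst hxr
    rw [h.map_root]
    exact hH.le_card.trans (card_le_card hH.sub_root)
  · exact hH.deg x hxr _ (h.good x hx hxr)

theorem Roomy.three_mul_le (h : τ.Roomy M G u A f) (hH : τ.Host M G M₀ u δ c) {x y z : W}
    (hx : x ∈ A) (hy : y ∈ A) (hz : z ∈ A) (hxy : x ≠ y) (hxz : x ≠ z) (hyz : y ≠ z) :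
    3 * δ ≤ #(avail M A f x ∪ avail M A f y ∪ avail M A f z) + 3 * c + #A := by
  have h1 := three_mul_le_card_union (h.le_card hH hx) (h.le_card hH hy) (h.le_card hH hz)
    (hH.inter x y _ _ (h.inj.ne hx hy hxy)) (hH.inter x z _ _ (h.inj.ne hx hz hxz))
    (hH.inter y z _ _ (h.inj.ne hy hz hyz))
  have h2 := le_card_sdiff (A.image f) (M x (f x) ∪ M y (f y) ∪ M z (f z))
  rw [h.card_image, union_sdiff_distrib, union_sdiff_distrib] at h2
  unfold avail
  omega

theorem Roomy.exists_insert (h : τ.Roomy M G u A f) (hH : τ.Host M G M₀ u ((k + 1) / 2) c)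
    (hB : τ.Bounded k c) {y : W} (hyi : y ∈ τ.inner) (hy : y ∉ A) (hp : τ.par y ∈ A) :
    ∃ v, τ.Roomy M G u (insert y A) (Function.update f y v) := by
  have hyr : y ≠ τ.root := fun e => hy (e ▸ h.closed.1)
  have hyk := mem_kids_par hyr
  have hpr : τ.par y ≠ τ.root := fun e =>
    hy (h.kids_root (mem_inter.2 ⟨e ▸ hyk, hyi⟩))
  have hGM : ∀ w ∈ avail M A f (τ.par y), w ∈ G y := fun w hw =>
    hH.good _ hpr _ (h.good _ hp hpr) y hyk (mem_sdiff.1 hw).1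
  have hfw : ∀ w ∈ avail M A f (τ.par y), ∀ x ∈ A, f x ≠ w := fun w hw x hx e =>
    (mem_sdiff.1 hw).2 (e ▸ mem_image_of_mem f hx)
  have hdegy : ∀ w ∈ avail M A f (τ.par y), (k + 1) / 2 ≤ #(M y w) := fun w hw =>
    hH.deg y hyr w (hGM w hw)
  have hdegA : ∀ x ∈ A, (k + 1) / 2 ≤ #(M x (f x)) := fun x hx => h.le_card hH hx
  have hcA : #(A.image f) = #A := h.card_image
  have hcl := h.closed.insert hp
  have hd : ∀ X ⊆ A, ∑ x ∈ X, τ.demand (insert y A) x + τ.demand (insert y A) y + 1 ≤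
      k + 1 - #A := by
    intro X hX
    have h1 := sum_demand_le hcl (X := insert y X) (insert_subset_insert _ hX)
    rw [sum_insert (fun e => hy (hX e)), card_sdiff_of_subset (subset_univ _),
      card_insert_of_notMem hy, card_univ, hB.card] at h1
    have h2 := card_le_univ (insert y A)
    rw [card_insert_of_notMem hy, hB.card] at h2
    omega
  have hm : τ.demand (insert y A) y = #(τ.kids y) + if τ.kids y ⊆ τ.inner then 1 else 0 := by
    have h1 : τ.kids y \ insert y A = τ.kids y := by
      refine sdiff_eq_self_of_disjoint (disjoint_left.2 fun w hw hw' => ?_)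
      rcases mem_insert.1 hw' with e | hw'
      · exact ne_of_mem_kids hw e
      · obtain ⟨h1, h2⟩ := mem_kids.1 hw
        exact hy (h2 ▸ h.closed.2 w hw' h1)
    have h2 : (τ.kids y).Nonempty := (mem_inner.1 hyi).resolve_left hyr
    simp [demand, h1, h2]
  have hAi : #A + 1 + (if τ.kids y ⊆ τ.inner then #(τ.kids y) else 0) ≤ #τ.inner := by
    have h1 : insert y A ⊆ τ.inner := insert_subset hyi h.sub
    split_ifs with hs
    · have h2 : Disjoint (insert y A) (τ.kids y) := by
        refine disjoint_left.2 fun w hw' hw => ?_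
        rcases mem_insert.1 hw' with e | hw'
        · exact ne_of_mem_kids hw e
        · obtain ⟨h1, h2⟩ := mem_kids.1 hw
          exact hy (h2 ▸ h.closed.2 w hw' h1)
      rw [← card_insert_of_notMem hy, ← card_union_of_disjoint h2]
      exact card_le_card (union_subset h1 hs)
    · rw [← card_insert_of_notMem hy]
      exact card_le_card h1
  have hl1 : #(τ.kids τ.root) + #(τ.kids y) + #τ.inner ≤ k + 2 := by
    have := sum_card_kids_add_card_inner_le (τ := τ) (X := {τ.root, y})
      (by simp [insert_subset_iff, root_mem_inner, hyi]) (by simp)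
    rw [sum_pair hyr.symm, card_pair hyr.symm, hB.card] at this
    omega
  have hl2 : ∀ x ∈ A, x ≠ τ.root →
      #(τ.kids τ.root) + #(τ.kids y) + #(τ.kids x) + #τ.inner ≤ k + 3 := by
    intro x hx hxr
    have hyx : y ≠ x := fun e => hy (e ▸ hx)
    have := sum_card_kids_add_card_inner_le (τ := τ) (X := {τ.root, y, x})
      (by simp [insert_subset_iff, root_mem_inner, hyi, h.sub hx]) (by simp)
    rw [sum_insert (by simp [hyr.symm, hxr.symm]), sum_pair hyx,
      card_insert_of_notMem (by simp [hyr.symm, hxr.symm]), card_pair hyx, hB.card] at this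
    omega
  have hroot : τ.demand (insert y A) τ.root + 1 ≤ #(τ.kids τ.root) := by
    have hsub : τ.kids τ.root ∩ τ.inner ⊆ insert y A :=
      h.kids_root.trans (subset_insert _ _)
    rw [demand_eq_of_subset hsub (insert_subset hyi h.sub)]
    obtain ⟨z, hz, hz'⟩ : ∃ z ∈ τ.kids τ.root, z ∈ τ.inner := by
      obtain ⟨z, hz1, hz2, hz3⟩ := (closed_root τ).exists_par_mem h.closed
        (fun hs => hpr (mem_singleton.1 (hs hp)))
      exact ⟨z, mem_kids.2 ⟨fun e => hz2 (mem_singleton.2 e), mem_singleton.1 hz3⟩, h.sub hz1⟩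
    exact card_lt_card ⟨sdiff_subset, fun hs => (mem_sdiff.1 (hs hz)).2 hz'⟩
  have hdx : ∀ x, τ.demand (insert y A) x ≤ #(τ.kids x) + 1 := fun x => demand_le
  have hky := hB.kids_le y hyr
  have hky' := hB.kids_lt y hyr
  have hc0 := hB.c_pos
  have hc1 := hB.c_lt
  generalize hmdef : τ.demand (insert y A) y = m at *
  obtain ⟨w, hw, c1, c2, c3, c4⟩ := exists_candidate A (τ.par y) hp (avail M A f)
    (fun w => M y w \ A.image f) (τ.demand (insert y A)) m (k + 1 - #A)
    (3 * ((k + 1) / 2) - 3 * c - #A) (4 * ((k + 1) / 2) - 6 * c - #A)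
    (fun w _ e => hH.self y w (mem_sdiff.1 e).1) (τ.demand A)
    (fun x _ hx => (demand_insert_of_ne hx).symm) (demand_insert_par hy hyr)
    (two_le_demand hy hyr hyi h.sub) h.one h.two
    (fun x hx y hy z hz hxy hxz hyz => by
      have := h.three_mul_le hH hx hy hz hxy hxz hyz
      omega)
    (fun x hx z hz w hw hxz => by
      have h1 := three_mul_le_card_union (hdegA x hx) (hdegA z hz) (hdegy w hw)
        (hH.inter _ _ _ _ (h.inj.ne hx hz hxz)) (hH.inter _ _ _ _ (hfw w hw x hx))
        (hH.inter _ _ _ _ (hfw w hw z hz))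
      have h2 := le_card_sdiff (A.image f) (M x (f x) ∪ M z (f z) ∪ M y w)
      rw [hcA, union_sdiff_distrib, union_sdiff_distrib] at h2
      unfold avail
      omega)
    (fun x hx w hw w' hw' hww => by
      have h1 := three_mul_le_card_union (hdegA x hx) (hdegy w hw) (hdegy w' hw')
        (hH.inter _ _ _ _ (hfw w hw x hx)) (hH.inter _ _ _ _ (hfw w' hw' x hx))
        (hH.inter _ _ _ _ hww)
      have h2 := le_card_sdiff (A.image f) (M x (f x) ∪ M y w ∪ M y w')
      rw [hcA, union_sdiff_distrib, union_sdiff_distrib] at h2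
      unfold avail
      omega)
    (fun w hw w' hw' w'' hw'' h12 h13 h23 => by
      have h1 := three_mul_le_card_union (hdegy w hw) (hdegy w' hw') (hdegy w'' hw'')
        (hH.inter y y _ _ h12) (hH.inter _ _ _ _ h13) (hH.inter _ _ _ _ h23)
      have h2 := le_card_sdiff (A.image f) (M y w ∪ M y w' ∪ M y w'')
      rw [hcA, union_sdiff_distrib, union_sdiff_distrib] at h2
      omega)
    (fun x hx z hz w hw w' hw' hxz hww => by
      have h1 := four_mul_le_card_union (hdegA x hx) (hdegA z hz) (hdegy w hw) (hdegy w' hw')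
        (hH.inter _ _ _ _ (h.inj.ne hx hz hxz)) (hH.inter _ _ _ _ (hfw w hw x hx))
        (hH.inter _ _ _ _ (hfw w hw z hz)) (hH.inter _ _ _ _ (hfw w' hw' x hx))
        (hH.inter _ _ _ _ (hfw w' hw' z hz)) (hH.inter _ _ _ _ hww)
      have h2 := le_card_sdiff (A.image f) (M x (f x) ∪ M z (f z) ∪ (M y w ∪ M y w'))
      rw [hcA, union_sdiff_distrib, union_sdiff_distrib, union_sdiff_distrib] at h2
      unfold avail
      omega)
    hd (by split_ifs at hm hAi <;> omega)
    (fun x hx => by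
      by_cases hxr : x = τ.root
      · subst hxr; split_ifs at hm hAi <;> omega
      · have := hl2 x hx hxr
        have := hdx x
        split_ifs at hm hAi <;> omega)
    (by split_ifs at hm hAi <;> omega) (by split_ifs at hm hAi <;> omega)
    (by split_ifs at hm hAi <;> omega)
  have hfx : ∀ x ∈ A, Function.update f y w x = f x := fun x hx =>
    Function.update_of_ne (ne_of_mem_of_not_mem hx hy) _ _
  have hax : ∀ x ∈ A, avail M (insert y A) (Function.update f y w) x = (avail M A f x).erase w := by
    intro x hx
    rw [avail, image_update hy, hfx x hx, sdiff_insert, avail]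
  have hay : avail M (insert y A) (Function.update f y w) y = (M y w \ A.image f).erase w := by
    rw [avail, image_update hy, Function.update_self, sdiff_insert]
  have hay' : avail M (insert y A) (Function.update f y w) y = M y w \ A.image f := by
    rw [hay, erase_eq_of_notMem (fun e => hH.self y w (mem_sdiff.1 e).1)]
  refine ⟨w, h.extend_one hy hp hw, insert_subset hyi h.sub,
    h.kids_root.trans (subset_insert _ _), ?_, ?_, ?_, ?_⟩
  · rw [hfx _ h.closed.1, h.map_root]
  · intro x hx hxr
    rcases mem_insert.1 hx with rfl | hx
    · rw [Function.update_self]; exact hGM w hw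
    · rw [hfx x hx]; exact h.good x hx hxr
  · intro x hx
    rcases mem_insert.1 hx with rfl | hx
    · rw [hay', hmdef]; exact c1
    · rw [hax x hx]; exact c2 x hx
  · have key : ∀ x ∈ A, m + τ.demand (insert y A) x ≤
        #(avail M (insert y A) (Function.update f y w) y ∪
          avail M (insert y A) (Function.update f y w) x) := by
      intro x hx
      rw [hay, hax x hx, ← erase_union_distrib]
      exact c4 x hx
    intro x hx z hz hxz
    rcases mem_insert.1 hx with hx' | hx' <;> rcases mem_insert.1 hz with hz' | hz'
    · exact absurd (hx'.trans hz'.symm) hxz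
    · rw [hx', hmdef]; exact key z hz'
    · rw [hz', hmdef, add_comm, union_comm]; exact key x hx'
    · rw [hax x hx', hax z hz', ← erase_union_distrib]
      exact c3 x hx' z hz' hxz

theorem card_kids_root_add_le (h : Fintype.card W = k + 1) :
    #(τ.kids τ.root) + #(τ.kids τ.root ∩ τ.inner) ≤ k := by
  have h1 := sum_card_kids_add_card_inner_le (τ := τ) (X := {τ.root})
    (by simp [root_mem_inner]) (by simp)
  rw [sum_singleton, card_singleton, h] at h1
  have h2 : τ.root ∉ τ.kids τ.root ∩ τ.inner := fun h => ne_of_mem_kids (mem_inter.1 h).1 rfl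
  have h3 := card_le_card (insert_subset (root_mem_inner (τ := τ))
    (inter_subset_right (s₁ := τ.kids τ.root)))
  rw [card_insert_of_notMem h2] at h3
  omega

theorem exists_injOn_of_card_le {Y : Finset W} {B : Finset V} (f : W → V) (h : #Y ≤ #B) :
    ∃ g : W → V, (∀ w ∈ Y, g w ∈ B) ∧ Set.InjOn g Y := by
  obtain ⟨C, hC, hCY⟩ := exists_subset_card_eq h
  let e := Y.equivOfCardEq hCY.symm
  refine ⟨fun w => if hw : w ∈ Y then e ⟨w, hw⟩ else f w, fun w hw => ?_, fun a ha b hb hab => ?_⟩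
  · simpa [hw] using hC (e ⟨w, hw⟩).2
  · rw [mem_coe] at ha hb
    simp only [ha, hb, dif_pos] at hab
    exact congrArg Subtype.val (e.injective (Subtype.ext hab))

theorem Host.exists_roomy (hH : τ.Host M G M₀ u ((k + 1) / 2) c) (hB : τ.Bounded k c) :
    ∃ A f, τ.Roomy M G u A f := by
  have hrk : τ.root ∉ τ.kids τ.root := fun h => ne_of_mem_kids h rfl
  set Y := τ.kids τ.root ∩ τ.inner with hY
  have hYi : #(τ.kids τ.root) + #Y ≤ k := card_kids_root_add_le (τ := τ) hB.card
  have hYj : #Y ≤ #(τ.kids τ.root) := card_le_card inter_subset_left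
  have hYpar : ∀ w ∈ Y, w ≠ τ.root ∧ τ.par w = τ.root := fun w hw =>
    mem_kids.1 (mem_inter.1 hw).1
  have hc0 := hB.c_pos
  have hc1 := hB.c_lt
  have hle := hH.le_card
  obtain ⟨g, hgM, hg⟩ := exists_injOn_of_card_le (fun _ => u) (show #Y ≤ #M₀ by omega)
  have huM := hH.self τ.root u
  have hdisj : Disjoint Y {τ.root} :=
    disjoint_singleton_right.2 fun h => hrk (mem_inter.1 h).1
  have hemb := (pemb_root (τ := τ) M u).extend hdisj
    (fun w hw => by simp [(hYpar w hw).2]) (g := g)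
    (fun w hw => by
      rw [(hYpar w hw).2]
      refine mem_sdiff.2 ⟨hH.sub_root (hgM w hw), fun h => huM ?_⟩
      rw [image_singleton, mem_singleton] at h
      exact h ▸ hH.sub_root (hgM w hw))
    hg
  set f := Y.piecewise g fun _ => u with hf
  set A := {τ.root} ∪ Y with hA
  have hfY : ∀ w ∈ Y, f w = g w := fun w hw => piecewise_eq_of_mem _ _ _ hw
  have hfr : f τ.root = u := piecewise_eq_of_notMem _ _ _ (disjoint_singleton_right.1 hdisj)
  have himg : A.image f = insert u (Y.image g) := by
    rw [hA, hf, image_piecewise hdisj, image_singleton, insert_eq]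
  have himgM : Y.image g ⊆ M τ.root u := fun v hv => by
    obtain ⟨w, hw, rfl⟩ := mem_image.1 hv
    exact hH.sub_root (hgM w hw)
  have hAi : A ⊆ τ.inner :=
    union_subset (singleton_subset_iff.2 root_mem_inner) inter_subset_right
  have hYA : Y ⊆ A := subset_union_right
  have hgood : ∀ x ∈ A, x ≠ τ.root → x ∈ τ.kids τ.root ∧ f x ∈ G x ∧ u ≠ f x := by
    intro x hx hxr
    have hxY := (mem_union.1 hx).resolve_left fun h => hxr (mem_singleton.1 h)
    rw [hfY x hxY]
    exact ⟨(mem_inter.1 hxY).1, hH.good_root x (mem_inter.1 hxY).1 (hgM x hxY), fun h =>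
      huM (h ▸ hH.sub_root (hgM x hxY))⟩
  have hdr : τ.demand A τ.root = #(τ.kids τ.root) - #Y := by
    have h1 : #(τ.kids τ.root \ τ.inner) + #Y = #(τ.kids τ.root) := card_sdiff_add_card_inter _ _
    rw [demand_eq_of_subset hYA hAi]
    omega
  have hdx : ∀ x ∈ A, x ≠ τ.root → τ.demand A x ≤ k / 4 + 2 := fun x _ hxr =>
    demand_le.trans (Nat.add_le_add_right (hB.kids_le x hxr) 1)
  have hroot : τ.demand A τ.root ≤ #(avail M A f τ.root) := by
    have h1 : avail M A f τ.root = M τ.root u \ Y.image g := by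
      rw [avail, hfr, himg]
      ext v
      simp only [mem_sdiff, mem_insert]
      constructor
      · tauto
      · rintro ⟨h1, h2⟩
        exact ⟨h1, fun h => h.elim (fun h => huM (h ▸ h1)) h2⟩
    have h2 := le_card_sdiff (Y.image g) (M τ.root u)
    rw [card_image_of_injOn hg] at h2
    rw [h1, hdr]
    have := hH.le_card_root
    omega
  have hsub : ∀ x, M x (f x) \ (insert u (M τ.root u)) ⊆ avail M A f x := by
    intro x
    rw [avail, himg]
    exact sdiff_subset_sdiff Subset.rfl (insert_subset_insert _ himgM)
  have hout : ∀ x ∈ A, x ≠ τ.root →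
      (k + 1) / 2 ≤ #(M x (f x) \ (insert u (M τ.root u))) + c + 1 := by
    intro x hx hxr
    obtain ⟨-, h1, h2⟩ := hgood x hx hxr
    have h3 := hH.deg x hxr _ h1
    have h4 := hH.inter x τ.root _ _ h2.symm
    have h5 := card_sdiff_add_card_inter (M x (f x)) (insert u (M τ.root u))
    have h6 : M x (f x) ∩ insert u (M τ.root u) ⊆ insert u (M x (f x) ∩ M τ.root u) := by
      intro v
      simp only [mem_inter, mem_insert]
      tauto
    have h7 := (card_le_card h6).trans (card_insert_le _ _)
    omega
  have hrx : ∀ x ∈ A, x ≠ τ.root → τ.demand A τ.root + τ.demand A x ≤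
      #(avail M A f τ.root ∪ avail M A f x) := by
    intro x hx hxr
    have h1 : Disjoint (avail M A f τ.root) (M x (f x) \ (insert u (M τ.root u))) := by
      refine disjoint_left.2 fun v hv hv' => (mem_sdiff.1 hv').2 (mem_insert_of_mem ?_)
      rw [avail, hfr] at hv
      exact (mem_sdiff.1 hv).1
    have h2 := card_le_card (union_subset_union_right (s := avail M A f τ.root) (hsub x))
    rw [card_union_of_disjoint h1] at h2
    have h3 := hout x hx hxr
    have h4 := hdx x hx hxr
    omega
  refine ⟨A, f, hemb, hAi, hYA, hfr, fun x hx hxr => (hgood x hx hxr).2.1, ?_, ?_⟩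
  · intro x hx
    by_cases hxr : x = τ.root
    · rw [hxr]; exact hroot
    · have h1 := hout x hx hxr
      have h2 := card_le_card (hsub x)
      have h3 := hdx x hx hxr
      omega
  · intro x hx y hy hxy
    by_cases hxr : x = τ.root
    · rw [hxr]; exact hrx y hy fun h => hxy (hxr.trans h.symm)
    by_cases hyr : y = τ.root
    · rw [hyr, add_comm, union_comm]; exact hrx x hx hxr
    obtain ⟨-, hx1, hx2⟩ := hgood x hx hxr
    obtain ⟨-, hy1, hy2⟩ := hgood y hy hyr
    have h1 := two_mul_le_card_union (hH.deg x hxr _ hx1) (hH.deg y hyr _ hy1)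
      (hH.inter x y _ _ (hemb.inj.ne hx hy hxy))
    have h2 := hH.inter x τ.root _ _ hx2.symm
    have h3 := hH.inter y τ.root _ _ hy2.symm
    have h4 := card_sdiff_add_card_inter (M x (f x) ∪ M y (f y)) (insert u (M τ.root u))
    have h5 : (M x (f x) ∪ M y (f y)) ∩ insert u (M τ.root u) ⊆
        insert u (M x (f x) ∩ M τ.root u ∪ M y (f y) ∩ M τ.root u) := by
      intro v
      simp only [mem_inter, mem_insert, mem_union]
      tauto
    have h5' := ((card_le_card h5).trans (card_insert_le _ _)).trans
      (Nat.add_le_add_right (card_union_le _ _) 1)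
    have h6 := card_le_card (union_subset_union (hsub x) (hsub y))
    rw [← union_sdiff_distrib] at h6
    have h7 := hdx x hx hxr
    have h8 := hdx y hy hyr
    have h9 : 2 * (k / 4 + 2) + 3 * c + 1 ≤ 2 * ((k + 1) / 2) := by
      clear * - hc0 hc1
      have : k % 4 < 4 := Nat.mod_lt _ (by norm_num)
      interval_cases hk : k % 4 <;> omega
    omega

theorem Host.exists_univ [Finite V] (hH : τ.Host M G M₀ u ((k + 1) / 2) c)
    (hB : τ.Bounded k c) : ∃ g, τ.PEmb M univ g := by
  obtain ⟨f, h⟩ : ∃ f, τ.Roomy M G u τ.inner f := by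
    obtain ⟨A, f, h⟩ := hH.exists_roomy hB
    induction hn : #(τ.inner \ A) generalizing A f with
    | zero =>
      rw [card_eq_zero, sdiff_eq_empty_iff_subset] at hn
      exact ⟨f, hn.antisymm h.sub ▸ h⟩
    | succ n ih =>
      obtain ⟨y, hyi, hy, hp⟩ := h.closed.exists_par_mem closed_inner fun hs => by
        rw [sdiff_eq_empty_iff_subset.2 hs, card_empty] at hn
        omega
      obtain ⟨v, hv⟩ := h.exists_insert hH hB hyi hy hp
      refine ih _ _ hv ?_
      rw [sdiff_insert, card_erase_of_mem (mem_sdiff.2 ⟨hyi, hy⟩), hn, Nat.add_sub_cancel]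
  refine h.exists_univ (fun w hw => par_mem_inner fun hr => hw (hr ▸ root_mem_inner))
    fun X hX => ?_
  have hdem : ∑ x ∈ X, #(τ.kids x \ τ.inner) ≤ ∑ x ∈ X, τ.demand τ.inner x :=
    sum_le_sum fun x _ => card_kids_sdiff_le_demand
  refine hdem.trans ?_
  have hbu : ∀ x ∈ X, avail M τ.inner f x ⊆ X.biUnion (avail M τ.inner f) := fun x hx =>
    subset_biUnion_of_mem _ hx
  rcases lt_or_ge 2 #X with h3 | h3
  · obtain ⟨x, hx, y, hy, z, hz, hxy, hxz, hyz⟩ := two_lt_card.1 h3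
    have h1 := h.three_mul_le hH (hX hx) (hX hy) (hX hz) hxy hxz hyz
    have h2 := card_le_card (union_subset (union_subset (hbu x hx) (hbu y hy)) (hbu z hz))
    have h3 := sum_demand_le closed_inner hX
    have h4 := card_le_univ τ.inner
    rw [card_sdiff_of_subset (subset_univ _), card_univ] at h3
    have := hB.card
    have := hB.c_lt
    have := hB.c_pos
    omega
  · interval_cases hX' : #X
    · simp [card_eq_zero.1 hX']
    · obtain ⟨x, rfl⟩ := card_eq_one.1 hX'
      rw [sum_singleton, singleton_biUnion]
      exact h.one x (hX (mem_singleton_self x))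
    · obtain ⟨x, y, hxy, rfl⟩ := card_eq_two.1 hX'
      rw [sum_pair hxy]
      refine (h.two x (hX (by simp)) y (hX (by simp)) hxy).trans (card_le_card ?_)
      exact union_subset (hbu x (by simp)) (hbu y (by simp))

/-- A host in which the image of the root has at least `k` neighbours. The vertices of the tree are
coloured alternately by `s`, and the good images of the vertices coloured like the root have degree
at least the degree `k - β` of the root. -/
structure BigHost (τ : ParentTree W) (M : W → V → Finset V) (G : W → Finset V) (u : V)
    (s : W → Bool) (k β c : ℕ) : Prop extends τ.Host M G (M τ.root u) u (β + 1) c where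
  alt : ∀ x, ∀ y ∈ τ.kids x, s y = !s x
  root : s τ.root = true
  co : ∀ x, ∀ y ∈ τ.kids x, ∀ v t, t ≠ v → #((M x v).filter fun w => t ∈ M y w) ≤ c
  deg_same : ∀ x, x ≠ τ.root → s x = true → ∀ v ∈ G x, k ≤ #(M x v) + β
  big : k ≤ #(M τ.root u)
  card : Fintype.card W = k + 1
  card_root : #(τ.kids τ.root) + β = k
  lt_card_root : β < #(τ.kids τ.root)
  c_pos : 0 < c
  c_lt : 12 * c < k

/-- A partial embedding into good vertices. -/
structure GoodEmb (τ : ParentTree W) (M : W → V → Finset V) (G : W → Finset V) (u : V)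
    (A : Finset W) (f : W → V) : Prop extends τ.PEmb M A f where
  map_root : f τ.root = u
  good : ∀ x ∈ A, x ≠ τ.root → f x ∈ G x

theorem goodEmb_root (M : W → V → Finset V) (G : W → Finset V) (u : V) :
    τ.GoodEmb M G u {τ.root} fun _ => u :=
  ⟨pemb_root M u, rfl, fun _ hx hxr => absurd (mem_singleton.1 hx) hxr⟩

theorem GoodEmb.mem_good (h : τ.GoodEmb M G u A f) (hH : τ.Host M G (M τ.root u) u δ c) {y : W}
    (hyr : y ≠ τ.root) (hp : τ.par y ∈ A) {v : V} (hv : v ∈ M (τ.par y) (f (τ.par y))) :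
    v ∈ G y := by
  by_cases hpr : τ.par y = τ.root
  · rw [hpr, h.map_root] at hv
    exact hH.good_root y (mem_kids.2 ⟨hyr, hpr⟩) hv
  · exact hH.good _ hpr _ (h.good _ hp hpr) y (mem_kids_par hyr) hv

theorem GoodEmb.le_card (h : τ.GoodEmb M G u A f) (hH : τ.Host M G (M τ.root u) u δ c) {x : W}
    (hx : x ∈ A) : δ ≤ #(M x (f x)) := by
  by_cases hxr : x = τ.root
  · subst hxr
    rw [h.map_root]
    exact hH.le_card
  · exact hH.deg x hxr _ (h.good x hx hxr)

theorem GoodEmb.extend (h : τ.GoodEmb M G u A f) (hH : τ.Host M G (M τ.root u) u δ c)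
    {Y : Finset W} (hY : Disjoint Y A)
    (hp : ∀ w ∈ Y, τ.par w ∈ A) {g : W → V} (hg : ∀ w ∈ Y, g w ∈ avail M A f (τ.par w))
    (hinj : Set.InjOn g Y) : τ.GoodEmb M G u (A ∪ Y) (Y.piecewise g f) := by
  refine ⟨h.toPEmb.extend hY hp hg hinj, ?_, fun x hx hxr => ?_⟩
  · rw [piecewise_eq_of_notMem _ _ _ fun hr => disjoint_left.1 hY hr h.closed.1, h.map_root]
  · by_cases hxY : x ∈ Y
    · rw [piecewise_eq_of_mem _ _ _ hxY]
      exact h.mem_good hH hxr (hp x hxY) (mem_sdiff.1 (hg x hxY)).1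
    · rw [piecewise_eq_of_notMem _ _ _ hxY]
      exact h.good x ((mem_union.1 hx).resolve_right hxY) hxr

theorem PEmb.card_le_card_avail (h : τ.PEmb M A f) (hM : ∀ x v, v ∉ M x v) {x : W} (hx : x ∈ A) :
    #(M x (f x)) + 1 ≤ #(avail M A f x) + #A := by
  have h1 : M x (f x) ∩ A.image f ⊆ (A.image f).erase (f x) := fun v hv =>
    mem_erase.2 ⟨fun e => hM x (f x) (e ▸ (mem_inter.1 hv).1), (mem_inter.1 hv).2⟩
  have h2 := card_le_card h1
  have h3 := card_erase_add_one (mem_image_of_mem f hx)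
  have h4 := card_sdiff_add_card_inter (M x (f x)) (A.image f)
  rw [h.card_image] at h3
  unfold avail
  omega

theorem BigHost.exists_univ_of_le [Finite V] (hH : τ.BigHost M G u s k β c) (hβ : 3 * c ≤ β) :
    ∃ g, τ.PEmb M univ g := by
  have hcard := hH.card
  have hcr := hH.card_root
  have hlt := hH.lt_card_root
  have hc0 := hH.c_pos
  have hin : #τ.inner ≤ β + 1 := by
    have := sum_card_kids_add_card_inner_le (τ := τ) (X := {τ.root})
      (by simp [root_mem_inner]) (by simp)
    rw [sum_singleton, card_singleton] at this
    omega
  obtain ⟨f, h⟩ : ∃ f, τ.GoodEmb M G u τ.inner f := by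
    obtain ⟨A, f, h, hA⟩ : ∃ A f, τ.GoodEmb M G u A f ∧ A ⊆ τ.inner :=
      ⟨_, _, goodEmb_root M G u, singleton_subset_iff.2 root_mem_inner⟩
    induction hn : #(τ.inner \ A) generalizing A f with
    | zero =>
      rw [card_eq_zero, sdiff_eq_empty_iff_subset] at hn
      exact ⟨f, hn.antisymm hA ▸ h⟩
    | succ n ih =>
      obtain ⟨y, hyi, hy, hp⟩ := h.closed.exists_par_mem closed_inner fun hs => by
        rw [sdiff_eq_empty_iff_subset.2 hs, card_empty] at hn
        omega
      have h1 := h.card_le_card_avail hH.self hp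
      have h2 := h.le_card hH.toHost hp
      have h3 := card_lt_card (ssubset_iff_of_subset hA |>.2 ⟨y, hyi, hy⟩)
      obtain ⟨v, hv⟩ := card_pos.1 (show 0 < #(avail M A f (τ.par y)) by omega)
      refine ih _ _ (h.extend hH.toHost (Y := {y}) (disjoint_singleton_left.2 hy)
        (by simpa using hp) (g := fun _ => v) (by simpa using hv) (by simp))
        (union_subset hA (singleton_subset_iff.2 hyi)) ?_
      rw [union_singleton, sdiff_insert, card_erase_of_mem (mem_sdiff.2 ⟨hyi, hy⟩), hn,
        Nat.add_sub_cancel]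
  refine h.exists_univ (fun w hw => par_mem_inner fun hr => hw (hr ▸ root_mem_inner))
    fun X hX => ?_
  have hsum : ∀ X ⊆ τ.inner, ∑ x ∈ X, #(τ.kids x \ τ.inner) + #τ.inner ≤ k + 1 := by
    intro X hX
    have h1 : ∑ x ∈ X, #(τ.kids x \ τ.inner) ≤ ∑ x ∈ X, τ.demand τ.inner x :=
      sum_le_sum fun x _ => card_kids_sdiff_le_demand
    have h2 := sum_demand_le closed_inner hX
    have h3 := card_le_univ τ.inner
    rw [card_sdiff_of_subset (subset_univ _), card_univ] at h2
    omega
  have hbu : ∀ x ∈ X, avail M τ.inner f x ⊆ X.biUnion (avail M τ.inner f) := fun x hx =>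
    subset_biUnion_of_mem _ hx
  by_cases hrX : τ.root ∈ X
  · have h1 := h.card_le_card_avail hH.self root_mem_inner
    rw [h.map_root] at h1
    have h2 := hH.big
    have h3 := card_le_card (hbu _ hrX)
    have h4 := hsum X hX
    omega
  have hcnt : ∀ x ∈ X, #(M x (f x)) + 1 ≤ #(avail M τ.inner f x) + #τ.inner := fun x hx =>
    h.card_le_card_avail hH.self (hX hx)
  have hdeg : ∀ x ∈ X, β + 1 ≤ #(M x (f x)) := fun x hx => h.le_card hH.toHost (hX hx)
  have hne : ∀ x ∈ X, τ.root ≠ x := fun x hx e => hrX (e ▸ hx)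
  have hle : ∀ x, #(τ.kids x \ τ.inner) ≤ #(τ.kids x) := fun x => card_le_card sdiff_subset
  rcases lt_or_ge 2 #X with h3 | h3
  · obtain ⟨x, hx, y, hy, z, hz, hxy, hxz, hyz⟩ := two_lt_card.1 h3
    have h1 := three_mul_le_card_union (hdeg x hx) (hdeg y hy) (hdeg z hz)
      (hH.inter _ _ _ _ (h.inj.ne (hX hx) (hX hy) hxy))
      (hH.inter _ _ _ _ (h.inj.ne (hX hx) (hX hz) hxz))
      (hH.inter _ _ _ _ (h.inj.ne (hX hy) (hX hz) hyz))
    have h2 := le_card_sdiff (τ.inner.image f) (M x (f x) ∪ M y (f y) ∪ M z (f z))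
    rw [h.card_image, union_sdiff_distrib, union_sdiff_distrib] at h2
    have h4 := card_le_card (union_subset (union_subset (hbu x hx) (hbu y hy)) (hbu z hz))
    unfold avail at h4
    have h5 := hsum (insert τ.root X) (insert_subset root_mem_inner hX)
    rw [sum_insert hrX] at h5
    have h6 := card_kids_root_add_le (τ := τ) hcard
    have h7 := card_sdiff_add_card_inter (τ.kids τ.root) τ.inner
    unfold avail
    omega
  · interval_cases hX' : #X
    · simp [card_eq_zero.1 hX']
    · obtain ⟨x, rfl⟩ := card_eq_one.1 hX'
      have hx := mem_singleton_self x
      have h1 := sum_card_kids_add_card_inner_le (τ := τ) (X := {τ.root, x})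
        (by simpa [insert_subset_iff, root_mem_inner] using hX) (by simp)
      rw [sum_pair (hne x hx), card_pair (hne x hx)] at h1
      have h2 := hcnt x hx
      have h3 := hdeg x hx
      have h4 := hle x
      rw [sum_singleton, singleton_biUnion]
      omega
    · obtain ⟨x, y, hxy, rfl⟩ := card_eq_two.1 hX'
      have hx : x ∈ ({x, y} : Finset W) := by simp
      have hy : y ∈ ({x, y} : Finset W) := by simp
      have h1 := sum_card_kids_add_card_inner_le (τ := τ) (X := {τ.root, x, y})
        (insert_subset root_mem_inner hX) (by simp)
      rw [sum_insert hrX, sum_pair hxy, card_insert_of_notMem hrX, card_pair hxy] at h1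
      have h2 := two_mul_le_card_union (hdeg x hx) (hdeg y hy)
        (hH.inter _ _ _ _ (h.inj.ne (hX hx) (hX hy) hxy))
      have h3 := le_card_sdiff (τ.inner.image f) (M x (f x) ∪ M y (f y))
      rw [h.card_image, union_sdiff_distrib] at h3
      have h4 := card_le_card (union_subset (hbu x hx) (hbu y hy))
      have h5 := hle x
      have h6 := hle y
      rw [sum_pair hxy]
      unfold avail at h4 ⊢
      omega

/-- Closedness under taking the children of the vertices coloured unlike the root. -/
def KidsClosed (τ : ParentTree W) (s : W → Bool) (A : Finset W) : Prop :=
  ∀ x ∈ A, s x = false → τ.kids x ⊆ A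

theorem BigHost.card_sub_le (hH : τ.BigHost M G u s k β c) (hA : τ.Closed A)
    (hAl : Disjoint A (τ.kids τ.root \ τ.inner)) (hk : τ.KidsClosed s A) {y : W} (hy : y ∉ A) :
    #A + 2 * #(τ.kids y) ≤ 2 * β + 1 := by
  have hyr : y ≠ τ.root := fun e => hy (e ▸ hA.1)
  have hrk : τ.root ∉ τ.kids τ.root := fun h => ne_of_mem_kids h rfl
  set Z := (A.erase τ.root) \ τ.kids τ.root with hZ
  have h1 : #(A ∩ τ.kids τ.root) ≤ #Z := by
    have hex : ∀ x ∈ A ∩ τ.kids τ.root, ∃ z, z ∈ τ.kids x := by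
      intro x hx
      obtain ⟨hxA, hxk⟩ := mem_inter.1 hx
      have hxi : x ∈ τ.inner := by
        by_contra hxi
        exact disjoint_left.1 hAl hxA (mem_sdiff.2 ⟨hxk, hxi⟩)
      exact (mem_inner.1 hxi).resolve_left (mem_kids.1 hxk).1
    choose! g hg using hex
    refine card_le_card_of_injOn g (fun x hx => ?_) fun a ha b hb hab => ?_
    · obtain ⟨hxA, hxk⟩ := mem_inter.1 hx
      have hgx := hg x hx
      refine mem_coe.2 (mem_sdiff.2 ⟨mem_erase.2 ⟨(mem_kids.1 hgx).1, hk x hxA ?_ hgx⟩,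
        fun h => ?_⟩)
      · rw [hH.alt _ x hxk, hH.root, Bool.not_true]
      · have := (mem_kids.1 h).2
        rw [(mem_kids.1 hgx).2] at this
        exact hrk (this ▸ hxk)
    · rw [← (mem_kids.1 (hg a ha)).2, hab, (mem_kids.1 (hg b hb)).2]
  have h2 : #A ≤ #(A ∩ τ.kids τ.root) + #Z + 1 := by
    have e1 : #Z + #(A.erase τ.root ∩ τ.kids τ.root) = #(A.erase τ.root) :=
      card_sdiff_add_card_inter _ _
    have e2 := card_erase_add_one hA.1
    have e3 := card_le_card (inter_subset_inter (erase_subset τ.root A)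
      (Subset.refl (τ.kids τ.root)))
    omega
  have h3 : #Z + #(τ.kids y) + #(τ.kids τ.root) + 1 ≤ k + 1 := by
    have hkA : ∀ w ∈ τ.kids y, w ∉ A := fun w hw hwA =>
      hy ((mem_kids.1 hw).2 ▸ hA.2 w hwA (mem_kids.1 hw).1)
    have d1 : Disjoint Z (τ.kids y) := disjoint_left.2 fun w hw hw' =>
      hkA w hw' (mem_erase.1 (mem_sdiff.1 hw).1).2
    have d2 : Disjoint (Z ∪ τ.kids y) (τ.kids τ.root) := disjoint_left.2 fun w hw hw' =>
      (mem_union.1 hw).elim (fun h => (mem_sdiff.1 h).2 hw') fun h =>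
        hyr ((mem_kids.1 h).2.symm.trans (mem_kids.1 hw').2)
    have d3 : τ.root ∉ Z ∪ τ.kids y ∪ τ.kids τ.root := by
      simp only [mem_union, not_or]
      exact ⟨⟨fun h => (mem_erase.1 (mem_sdiff.1 h).1).1 rfl, fun h => (mem_kids.1 h).1 rfl⟩, hrk⟩
    rw [← card_union_of_disjoint d1, ← card_union_of_disjoint d2, ← card_insert_of_notMem d3,
      ← hH.card]
    exact card_le_univ _
  have := hH.card_root
  omega

theorem BigHost.exists_image (hH : τ.BigHost M G u s k β c) (hβ : β < 3 * c)
    (h : τ.GoodEmb M G u A f) (hAl : Disjoint A (τ.kids τ.root \ τ.inner))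
    (hk : τ.KidsClosed s A) {y : W} (hy : y ∉ A) (hp : τ.par y ∈ A) :
    ∃ v ∈ avail M A f (τ.par y), #(τ.kids y) ≤ #(M y v \ A.image f) := by
  have hyr : y ≠ τ.root := fun e => hy (e ▸ h.closed.1)
  have hyk := mem_kids_par hyr
  have hsp : s (τ.par y) = true := by
    by_contra hs
    exact hy (hk _ hp (Bool.eq_false_iff.2 hs) hyk)
  have hA := hH.card_sub_le h.closed hAl hk hy
  have hcard := hH.card_root
  have hc0 := hH.c_pos
  have hc1 := hH.c_lt
  set C := avail M A f (τ.par y) with hC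
  have hCc : 2 * c ≤ #C := by
    have h1 : #(M (τ.par y) (f (τ.par y))) + 1 ≤ #C + #A := h.card_le_card_avail hH.self hp
    have h2 : k ≤ #(M (τ.par y) (f (τ.par y))) + β := by
      by_cases hpr : τ.par y = τ.root
      · rw [hpr, h.map_root]
        exact hH.big.trans (Nat.le_add_right _ _)
      · exact hH.deg_same _ hpr hsp _ (h.good _ hp hpr)
    omega
  by_contra! hcon
  have h1 : #C * (β + 2 - #(τ.kids y)) ≤ ∑ v ∈ C, #((A.image f).filter fun t => t ∈ M y v) := by
    rw [← smul_eq_mul]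
    refine card_nsmul_le_sum _ _ _ fun v hv => ?_
    have e1 := hcon v hv
    have e2 := hH.deg y hyr v (h.mem_good hH.toHost hyr hp (mem_sdiff.1 hv).1)
    have e3 := card_sdiff_add_card_inter (M y v) (A.image f)
    rw [inter_comm, ← filter_mem_eq_inter] at e3
    omega
  have h2 : ∑ v ∈ C, #((A.image f).filter fun t => t ∈ M y v) ≤ (#A - 1) * c + #C := by
    have e := sum_card_bipartiteAbove_eq_sum_card_bipartiteBelow (s := C) (t := A.image f)
      (fun v t => t ∈ M y v)
    simp only [bipartiteAbove, bipartiteBelow] at e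
    rw [e, ← add_sum_erase _ _ (mem_image_of_mem f hp), add_comm]
    refine Nat.add_le_add ?_ (card_filter_le _ _)
    rw [← h.card_image, ← card_erase_of_mem (mem_image_of_mem f hp), ← smul_eq_mul]
    refine sum_le_card_nsmul _ _ _ fun t ht => ?_
    refine le_trans (card_le_card ?_) (hH.co _ y hyk (f (τ.par y)) t (ne_of_mem_erase ht))
    exact filter_subset_filter _ sdiff_subset
  have h3 : #(τ.kids y) ≤ β := by
    have := card_pos.2 ⟨_, h.closed.1⟩
    omega
  obtain ⟨t, ht⟩ := Nat.exists_eq_add_of_le h3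
  have h4 : β + 2 - #(τ.kids y) = t + 2 := by omega
  have h5 : #A - 1 ≤ 2 * t := by omega
  rw [h4] at h1
  have h6 := Nat.mul_le_mul_right c h5
  have h7 := Nat.mul_le_mul_right (t + 1) hCc
  nlinarith

theorem BigHost.exists_univ_of_lt (hH : τ.BigHost M G u s k β c) (hβ : β < 3 * c) :
    ∃ g, τ.PEmb M univ g := by
  set B := univ \ (τ.kids τ.root \ τ.inner) with hB
  have hBc : τ.Closed B := by
    refine ⟨mem_sdiff.2 ⟨mem_univ _, fun h => ne_of_mem_kids (mem_sdiff.1 h).1 rfl⟩,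
      fun w _ hw => mem_sdiff.2 ⟨mem_univ _, fun h => (mem_sdiff.1 h).2 (par_mem_inner hw)⟩⟩
  have hdis : ∀ A ⊆ B, Disjoint A (τ.kids τ.root \ τ.inner) := fun A hA =>
    disjoint_left.2 fun w hw => (mem_sdiff.1 (hA hw)).2
  obtain ⟨f, h⟩ : ∃ f, τ.GoodEmb M G u B f := by
    obtain ⟨A, f, h, hA, hk⟩ : ∃ A f, τ.GoodEmb M G u A f ∧ A ⊆ B ∧ τ.KidsClosed s A := by
      refine ⟨_, _, goodEmb_root M G u, singleton_subset_iff.2 hBc.1, fun x hx hs => ?_⟩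
      rw [mem_singleton.1 hx, hH.root] at hs
      exact absurd hs (by decide)
    induction hn : #(B \ A) using Nat.strong_induction_on generalizing A f with
    | _ n ih =>
      by_cases hBA : B ⊆ A
      · exact ⟨f, hBA.antisymm hA ▸ h⟩
      obtain ⟨y, hyB, hy, hp⟩ := h.closed.exists_par_mem hBc hBA
      have hyr : y ≠ τ.root := fun e => hy (e ▸ h.closed.1)
      have hsy : s y = false := by
        rw [hH.alt _ y (mem_kids_par hyr)]
        by_contra hs
        exact hy (hk _ hp (by simpa using hs) (mem_kids_par hyr))
      obtain ⟨v, hv, hvc⟩ := hH.exists_image hβ h (hdis A hA) hk hy hp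
      have hdy : Disjoint {y} A := disjoint_singleton_left.2 hy
      have h1 := h.extend hH.toHost hdy (by simpa using hp) (g := fun _ => v) (by simpa using hv)
        (by simp)
      set f' := ({y} : Finset W).piecewise (fun _ => v) f with hf'
      have himg : (A ∪ {y}).image f' = A.image f ∪ {v} := by
        rw [hf', image_piecewise hdy, image_singleton]
      have hfy : f' y = v := piecewise_eq_of_mem _ _ _ (mem_singleton_self y)
      obtain ⟨g, hg, hgi⟩ := exists_injOn_of_card_le f' hvc
      have hkd : Disjoint (τ.kids y) (A ∪ {y}) := by
        refine disjoint_left.2 fun w hw hw' => ?_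
        rcases mem_union.1 hw' with hw' | hw'
        · exact hy ((mem_kids.1 hw).2 ▸ h.closed.2 w hw' (mem_kids.1 hw).1)
        · exact ne_of_mem_kids hw (mem_singleton.1 hw')
      have h2 := h1.extend hH.toHost hkd (fun w hw => by simp [(mem_kids.1 hw).2]) (g := g)
        (fun w hw => by
          rw [(mem_kids.1 hw).2, avail, himg, hfy]
          have := mem_sdiff.1 (hg w hw)
          refine mem_sdiff.2 ⟨this.1, fun h' => ?_⟩
          rcases mem_union.1 h' with h' | h'
          · exact this.2 h'
          · exact hH.self y v (mem_singleton.1 h' ▸ this.1)) hgi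
      refine ih _ ?_ _ _ h2 ?_ ?_ rfl
      · rw [← hn]
        refine card_lt_card ⟨sdiff_subset_sdiff Subset.rfl
          (subset_union_left.trans subset_union_left), fun hs => ?_⟩
        have := hs (mem_sdiff.2 ⟨hyB, hy⟩)
        simp at this
      · refine union_subset (union_subset hA (singleton_subset_iff.2 hyB)) fun w hw =>
          mem_sdiff.2 ⟨mem_univ _, fun hw' => ?_⟩
        exact hyr ((mem_kids.1 hw).2.symm.trans (mem_kids.1 (mem_sdiff.1 hw').1).2)
      · intro x hx hs
        rcases mem_union.1 hx with hx | hx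
        · rcases mem_union.1 hx with hx | hx
          · exact (hk x hx hs).trans (subset_union_left.trans subset_union_left)
          · rw [mem_singleton.1 hx]
            exact subset_union_right
        · rw [hH.alt y x hx, hsy] at hs
          exact absurd hs (by decide)
  have hav : #(τ.kids τ.root \ τ.inner) ≤ #(avail M B f τ.root) := by
    have h1 := h.card_le_card_avail hH.self hBc.1
    rw [h.map_root] at h1
    have h2 := hH.big
    have h3 : #B + #(τ.kids τ.root \ τ.inner) = #(univ : Finset W) :=
      card_sdiff_add_card_eq_card (subset_univ _)
    rw [card_univ, hH.card] at h3
    omega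
  obtain ⟨g, hg, hgi⟩ := exists_injOn_of_card_le f hav
  have h2 := h.extend hH.toHost (hdis B Subset.rfl).symm
    (fun w hw => by rw [(mem_kids.1 (mem_sdiff.1 hw).1).2]; exact hBc.1) (g := g)
    (fun w hw => by rw [(mem_kids.1 (mem_sdiff.1 hw).1).2]; exact hg w hw) hgi
  rw [hB, sdiff_union_of_subset (subset_univ _)] at h2
  exact ⟨_, h2.toPEmb⟩

theorem BigHost.exists_univ [Finite V] (hH : τ.BigHost M G u s k β c) : ∃ g, τ.PEmb M univ g :=
  (le_or_gt (3 * c) β).elim hH.exists_univ_of_le hH.exists_univ_of_lt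

end ParentTree

/-- Deleting vertices of small degree from a dense bipartite graph. -/
theorem exists_dense_core {X Y : Type*} [DecidableEq X] [DecidableEq Y] (E : X → Y → Prop)
    [∀ x y, Decidable (E x y)] {α β : ℕ} (P : Finset X) (M : Finset Y)
    (h : α * #P + β * #M < 2 * ∑ x ∈ P, #{y ∈ M | E x y}) :
    ∃ P' ⊆ P, ∃ M' ⊆ M, α * #P' + β * #M' < 2 * ∑ x ∈ P', #{y ∈ M' | E x y} ∧
      (∀ x ∈ P', α < 2 * #{y ∈ M' | E x y}) ∧ ∀ y ∈ M', β < 2 * #{x ∈ P' | E x y} := by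
  induction hn : #P + #M using Nat.strong_induction_on generalizing P M with
  | _ n ih =>
    by_cases hP : ∀ x ∈ P, α < 2 * #{y ∈ M | E x y}
    · by_cases hM : ∀ y ∈ M, β < 2 * #{x ∈ P | E x y}
      · exact ⟨P, Subset.rfl, M, Subset.rfl, h, hP, hM⟩
      · push Not at hM
        obtain ⟨y, hy, hyd⟩ := hM
        have hc := card_erase_add_one hy
        have hswap : ∀ M : Finset Y,
            ∑ x ∈ P, #{y ∈ M | E x y} = ∑ y ∈ M, #{x ∈ P | E x y} := fun M =>
          sum_card_bipartiteAbove_eq_sum_card_bipartiteBelow E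
        have hs := add_sum_erase M (fun y => #{x ∈ P | E x y}) hy
        obtain ⟨P', hP', M', hM', h'⟩ := ih (#P + #(M.erase y)) (by omega) P (M.erase y) (by
          rw [hswap] at h ⊢
          rw [← hc, mul_add] at h
          omega) rfl
        exact ⟨P', hP', M', hM'.trans (erase_subset _ _), h'⟩
    · push Not at hP
      obtain ⟨x, hx, hxd⟩ := hP
      have hc := card_erase_add_one hx
      have hs := add_sum_erase P (fun x => #{y ∈ M | E x y}) hx
      obtain ⟨P', hP', M', hM', h'⟩ := ih (#(P.erase x) + #M) (by omega) (P.erase x) M (by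
        rw [← hc, mul_add] at h
        omega) rfl
      exact ⟨P', hP'.trans (erase_subset _ _), M', hM', h'⟩

/-- Signed neighbourhoods of a digraph, any two of which at distinct vertices have at most `c`
common elements. -/
structure SparseNbr {V : Type*} [DecidableEq V] (N : Bool → V → Finset V) (c : ℕ) : Prop where
  self : ∀ b v, v ∉ N b v
  mem_iff : ∀ b v w, w ∈ N b v ↔ v ∈ N (!b) w
  inter : ∀ b b' v v', v ≠ v' → #(N b v ∩ N b' v') ≤ c

namespace SparseNbr

variable {V : Type*} [DecidableEq V] {N : Bool → V → Finset V} {c : ℕ}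

theorem exists_dense_core (hN : SparseNbr N c) (b : Bool) {α β : ℕ} (P M : Finset V)
    (h : α * #P + β * #M < 2 * ∑ x ∈ P, #(M ∩ N b x)) :
    ∃ P' ⊆ P, ∃ M' ⊆ M, α * #P' + β * #M' < 2 * ∑ x ∈ P', #(M' ∩ N b x) ∧
      (∀ x ∈ P', α < 2 * #(M' ∩ N b x)) ∧ ∀ y ∈ M', β < 2 * #(P' ∩ N (!b) y) := by
  obtain ⟨P', hP', M', hM', h⟩ := _root_.exists_dense_core (fun x y => y ∈ N b x) P M
    (α := α) (β := β) (by simpa only [filter_mem_eq_inter] using h)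
  refine ⟨P', hP', M', hM', ?_⟩
  simp only [hN.mem_iff b _ _] at h
  simp only [filter_mem_eq_inter] at h
  simpa only [← hN.mem_iff b _ _, filter_mem_eq_inter] using h

end SparseNbr

namespace ParentTree

variable {W V : Type*} [Fintype W] [DecidableEq W] [DecidableEq V] {τ : ParentTree W}
  {N : Bool → V → Finset V} {s : W → Bool} {k c : ℕ} {P M : Finset V} {u : V}

theorem exists_embedding_of_core [Finite V] (hN : SparseNbr N c) (hB : τ.Bounded k c)
    (hs : ∀ w, w ≠ τ.root → s w = !s (τ.par w))
    (hP : ∀ x ∈ P, k - 1 < 2 * #(M ∩ N (s τ.root) x))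
    (hM : ∀ y ∈ M, k - 1 < 2 * #(P ∩ N (!s τ.root) y)) (hu : u ∈ P)
    (hd : #(τ.kids τ.root) ≤ #(N (s τ.root) u)) :
    ∃ g : W → V, g.Injective ∧ ∀ w, w ≠ τ.root → g w ∈ N (s (τ.par w)) (g (τ.par w)) := by
  set b := s τ.root with hb
  have hk : ∀ x, ∀ y ∈ τ.kids x, s y = !s x := fun x y hy => by
    rw [hs y (mem_kids.1 hy).1, (mem_kids.1 hy).2]
  have hH : τ.Host
      (fun x v => if x = τ.root then N b v else (if s x = b then M else P) ∩ N (s x) v)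
      (fun x => if s x = b then P else M) (M ∩ N b u) u ((k + 1) / 2) c := by
    have hsub : ∀ x v,
        (if x = τ.root then N b v else (if s x = b then M else P) ∩ N (s x) v) ⊆ N (s x) v := by
      intro x v
      split_ifs with h
      · rw [h]
      all_goals exact inter_subset_right
    refine ⟨fun x v h => hN.self _ _ (hsub x v h), fun x y v v' h =>
      (card_le_card (inter_subset_inter (hsub x v) (hsub y v'))).trans (hN.inter _ _ _ _ h),
      ?_, ?_, ?_, ?_, ?_, ?_⟩
    · simp
    · intro y hy
      rw [hk _ y hy, ← hb]
      simp
    · intro x hx v hv y hy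
      rw [hk x y hy, if_neg hx]
      by_cases h : s x = b
      · simp [h]
      · have : (!s x) = b := by rw [Bool.not_eq.2 h]
        simp [h, this]
    · intro x hx v hv
      rw [if_neg hx]
      by_cases h : s x = b
      · rw [if_pos h] at hv ⊢
        rw [h]
        have := hP v hv
        omega
      · rw [if_neg h] at hv ⊢
        rw [Bool.eq_not.2 h]
        have := hM v hv
        omega
    · have := hP u hu
      omega
    · simpa using hd
  obtain ⟨g, hg⟩ := hH.exists_univ hB
  refine ⟨g, fun a b h => hg.inj (by simp) (by simp) h, fun w hw => ?_⟩
  have h := hg.mem w (mem_univ _) hw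
  split_ifs at h with h1
  · rw [h1] at h ⊢
    exact h
  all_goals exact (mem_inter.1 h).2

theorem exists_embedding_of_big [Finite V] (hN : SparseNbr N c) (hB : τ.Bounded k c)
    (hs : ∀ w, w ≠ τ.root → s w = !s (τ.par w)) {β : ℕ} (hβ : #(τ.kids τ.root) + β = k)
    (hlt : β < #(τ.kids τ.root))
    (hP : ∀ x ∈ P, k ≤ #(M ∩ N (s τ.root) x) + β)
    (hM : ∀ y ∈ M, β < #(P ∩ N (!s τ.root) y)) (hu : k ≤ #(M ∩ N (s τ.root) u)) :
    ∃ g : W → V, g.Injective ∧ ∀ w, w ≠ τ.root → g w ∈ N (s (τ.par w)) (g (τ.par w)) := by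
  set b := s τ.root with hb
  have hk : ∀ x, ∀ y ∈ τ.kids x, s y = !s x := fun x y hy => by
    rw [hs y (mem_kids.1 hy).1, (mem_kids.1 hy).2]
  have hH : τ.BigHost (fun x v => (if s x = b then M else P) ∩ N (s x) v)
      (fun x => if s x = b then P else M) u (fun x => s x == b) k β c := by
    have hsub : ∀ x v, (if s x = b then M else P) ∩ N (s x) v ⊆ N (s x) v :=
      fun x v => inter_subset_right
    refine ⟨⟨fun x v h => hN.self _ _ (hsub x v h), fun x y v v' h =>
      (card_le_card (inter_subset_inter (hsub x v) (hsub y v'))).trans (hN.inter _ _ _ _ h),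
      Subset.rfl, ?_, ?_, ?_, ?_, ?_⟩, ?_, ?_, ?_, ?_, ?_, hB.card, hβ, hlt, hB.c_pos, hB.c_lt⟩
    · intro y hy
      rw [hk _ y hy, ← hb]
      simp
    · intro x hx v hv y hy
      rw [hk x y hy]
      by_cases h : s x = b
      · simp [h]
      · have : (!s x) = b := by rw [Bool.not_eq.2 h]
        simp [h, this]
    · intro x hx v hv
      by_cases h : s x = b
      · rw [if_pos h] at hv ⊢
        rw [h]
        have := hP v hv
        omega
      · rw [if_neg h] at hv ⊢
        rw [Bool.eq_not.2 h]
        exact hM v hv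
    · rw [← hb, if_pos rfl]
      omega
    · rw [← hb, if_pos rfl]
      omega
    · intro x y hy
      rw [hk x y hy]
      cases s x <;> cases b <;> rfl
    · simp [hb]
    · intro x y hy v t ht
      refine (card_le_card fun w hw => ?_).trans (hN.inter (s x) (s x) v t ht.symm)
      obtain ⟨h1, h2⟩ := mem_filter.1 hw
      have h2 := hsub y w h2
      rw [hk x y hy, ← hN.mem_iff] at h2
      exact mem_inter.2 ⟨hsub x v h1, h2⟩
    · intro x _ h v hv
      have h : s x = b := by simpa using h
      rw [if_pos h] at hv ⊢
      rw [h]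
      exact hP v hv
    · rw [← hb, if_pos rfl]
      exact hu
  obtain ⟨g, hg⟩ := hH.exists_univ
  exact ⟨g, fun a b h => hg.inj (by simp) (by simp) h, fun w hw =>
    (mem_inter.1 (hg.mem w (mem_univ _) hw)).2⟩

theorem exists_embedding [Fintype V] (hN : SparseNbr N c) (hB : τ.Bounded k c)
    (hs : ∀ w, w ≠ τ.root → s w = !s (τ.par w))
    (hk : (k - 1) * Fintype.card V < ∑ v, #(N (s τ.root) v)) :
    ∃ g : W → V, g.Injective ∧ ∀ w, w ≠ τ.root → g w ∈ N (s (τ.par w)) (g (τ.par w)) := by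
  have hd : #(τ.kids τ.root) ≤ k := by
    have h1 := τ.sum_card_kids_add_one
    have h2 := single_le_sum (f := fun x => #(τ.kids x)) (fun _ _ => Nat.zero_le _)
      (mem_univ τ.root)
    rw [hB.card] at h1
    omega
  have hc0 := hB.c_pos
  have hc := hB.c_lt
  set d := #(τ.kids τ.root) with hdd
  by_cases hdk : d ≤ (k + 1) / 2
  · obtain ⟨P, -, M, -, h, hP, hM⟩ := hN.exists_dense_core (s τ.root) (α := k - 1) (β := k - 1)
      univ univ (by
        simp only [card_univ, univ_inter]
        omega)
    obtain ⟨u, hu⟩ : P.Nonempty := by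
      rw [nonempty_iff_ne_empty]
      rintro rfl
      simp at h
    refine exists_embedding_of_core hN hB hs hP hM hu ?_
    have h1 := hP u hu
    have h2 := card_le_card (inter_subset_right (s₁ := M) (s₂ := N (s τ.root) u))
    omega
  · obtain ⟨β, hβ⟩ := Nat.exists_eq_add_of_le hd
    obtain ⟨P, -, M, -, h, hP, hM⟩ := hN.exists_dense_core (s τ.root) (α := 2 * (d - 1))
      (β := 2 * β) univ univ (by
        simp only [card_univ, univ_inter]
        have : 2 * (d - 1) * Fintype.card V + 2 * β * Fintype.card V
            = 2 * ((k - 1) * Fintype.card V) := by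
          rw [show k - 1 = (d - 1) + β by omega]
          ring
        omega)
    rcases le_or_gt #P #M with hPM | hPM
    · obtain ⟨u, -, hu⟩ : ∃ u ∈ P, k ≤ #(M ∩ N (s τ.root) u) := by
        by_contra! hcon
        have h1 : ∑ x ∈ P, #(M ∩ N (s τ.root) x) ≤ #P * (k - 1) :=
          sum_le_card_nsmul _ _ _ fun x hx => by
            have := hcon x hx
            omega
        have h2 : 2 * β * #P ≤ 2 * β * #M := Nat.mul_le_mul_left _ hPM
        rw [show k - 1 = (d - 1) + β by omega] at h1
        nlinarith
      refine exists_embedding_of_big (P := P) hN hB hs hβ.symm (by omega) (fun x hx => ?_)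
        (fun y hy => ?_) hu
      · have := hP x hx
        omega
      · have := hM y hy
        omega
    · obtain ⟨P', hP', M', hM', h', hPd, hMd⟩ := hN.exists_dense_core (s τ.root) (α := k - 1)
        (β := k - 1) P M (by
          refine lt_of_le_of_lt ?_ h
          obtain ⟨t, ht⟩ := Nat.exists_eq_add_of_le hPM.le
          obtain ⟨j, hj⟩ := Nat.exists_eq_add_of_le (show β ≤ d - 1 by omega)
          rw [ht, show k - 1 = 2 * β + j by omega, hj]
          nlinarith [Nat.zero_le (j * t)])
      obtain ⟨u, hu⟩ : P'.Nonempty := by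
        rw [nonempty_iff_ne_empty]
        rintro rfl
        simp at h'
      refine exists_embedding_of_core hN hB hs hPd hMd hu ?_
      have h1 := hP u (hP' hu)
      have h2 := card_le_card (inter_subset_right (s₁ := M) (s₂ := N (s τ.root) u))
      omega

/-- Rooting a tree at a vertex. -/
theorem exists_adj_iff {W : Type*} [Fintype W] [DecidableEq W] {G : SimpleGraph W} (hG : G.IsTree)
    (r : W) : ∃ τ : ParentTree W, τ.root = r ∧
      ∀ x y, G.Adj x y ↔ y ∈ τ.kids x ∨ x ∈ τ.kids y := by
  classical
  have hex : ∀ w, w ≠ r → ∃ v, G.Adj w v ∧ G.dist v r < G.dist w r := by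
    intro w hw
    obtain ⟨p, hp⟩ := hG.connected.exists_walk_length_eq_dist w r
    cases p with
    | nil => exact absurd rfl hw
    | cons h q =>
      refine ⟨_, h, ?_⟩
      rw [← hp, SimpleGraph.Walk.length_cons]
      exact Nat.lt_succ_of_le (SimpleGraph.dist_le q)
  choose! par hadj hdep using hex
  let τ : ParentTree W := ⟨r, par, fun w => G.dist w r, hdep⟩
  refine ⟨τ, rfl, fun x y => ⟨fun h => ?_, ?_⟩⟩
  · have hinj : Set.InjOn (fun w => s(w, par w)) (univ.erase r : Finset W) := by
      intro a ha b hb hab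
      rcases Sym2.eq_iff.1 hab with h | h
      · exact h.1
      · have h1 := hdep a (mem_erase.1 ha).1
        have h2 := hdep b (mem_erase.1 hb).1
        rw [h.2] at h1
        rw [← h.1] at h2
        exact absurd h1 h2.asymm
    have hsub : (univ.erase r).image (fun w => s(w, par w)) ⊆ G.edgeFinset := by
      intro e he
      obtain ⟨w, hw, rfl⟩ := mem_image.1 he
      exact SimpleGraph.mem_edgeFinset.2 (hadj w (mem_erase.1 hw).1)
    have heq := eq_of_subset_of_card_le hsub (by
      rw [card_image_of_injOn hinj, card_erase_of_mem (mem_univ r), card_univ]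
      have := hG.card_edgeFinset
      omega)
    have hmem : s(x, y) ∈ G.edgeFinset := SimpleGraph.mem_edgeFinset.2 h
    rw [← heq] at hmem
    obtain ⟨w, hw, hwe⟩ := mem_image.1 hmem
    rcases Sym2.eq_iff.1 hwe with ⟨rfl, rfl⟩ | ⟨rfl, rfl⟩
    · exact Or.inr (mem_kids.2 ⟨(mem_erase.1 hw).1, rfl⟩)
    · exact Or.inl (mem_kids.2 ⟨(mem_erase.1 hw).1, rfl⟩)
  · rintro (h | h)
    · obtain ⟨h1, rfl⟩ := mem_kids.1 h
      exact (hadj y h1).symm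
    · obtain ⟨h1, rfl⟩ := mem_kids.1 h
      exact hadj x h1

end ParentTree

section Nbr

variable {V : Type*} [Fintype V]

theorem mem_nbr_true {A : V → V → Bool} {x y : V} : y ∈ nbr A true x ↔ A x y = true := by
  simp [nbr, outNbr]

theorem mem_nbr_false {A : V → V → Bool} {x y : V} : y ∈ nbr A false x ↔ A y x = true := by
  simp [nbr, inNbr]

theorem sum_card_nbr (A : V → V → Bool) (b : Bool) : ∑ v, #(nbr A b v) = arcCount A := by
  cases b
  · simp only [arcCount, nbr, inNbr, card_filter, ← univ_product_univ, sum_product_right,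
      Bool.false_eq_true, if_false]
  · simp only [arcCount, nbr, outNbr, card_filter, ← univ_product_univ, sum_product, if_true]

theorem K2sFree.sparseNbr [DecidableEq V] {D : V → V → Bool} {c : ℕ} (hD : K2sFree D (c + 1))
    (hl : Loopless D) : SparseNbr (nbr D) c := by
  have hself : ∀ b v, v ∉ nbr D b v := by
    rintro (_ | _) v h
    · exact hl v (mem_nbr_false.1 h)
    · exact hl v (mem_nbr_true.1 h)
  refine ⟨hself, ?_, fun b b' v v' hv => ?_⟩
  · rintro (_ | _) v w
    · exact mem_nbr_false.trans mem_nbr_true.symm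
    · exact mem_nbr_true.trans mem_nbr_false.symm
  · by_contra! h
    obtain ⟨S, hS, hc⟩ := exists_subset_card_eq (Nat.succ_le_of_lt h)
    exact hD ⟨v, v', b, b', S, hv, hc, fun h => hself b v (mem_inter.1 (hS h)).1,
      fun h => hself b' v' (mem_inter.1 (hS h)).2, hS⟩

theorem SparseNbr.sum_card_le [DecidableEq V] {N : Bool → V → Finset V} (hN : SparseNbr N 0)
    (b : Bool) : ∑ v, #(N b v) ≤ Fintype.card V := by
  rw [← card_biUnion fun v _ v' _ hv =>
    disjoint_iff_inter_eq_empty.2 (card_eq_zero.1 (Nat.le_zero.1 (hN.inter b b v v' hv)))]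
  exact card_le_univ _

end Nbr

section Tree

variable {W : Type*} [Fintype W] [DecidableEq W] {T : W → W → Bool} {τ : ParentTree W}

theorem Antidirected.underG_adj (hT : Antidirected T) {x y : W} :
    (underG T).Adj x y ↔ T x y ∨ T y x := by
  refine (SimpleGraph.fromRel_adj _ x y).trans (and_iff_right_of_imp ?_)
  rintro h rfl
  exact hT x x x (h.elim id id) (h.elim id id)

theorem Antidirected.totalDeg_eq (hT : Antidirected T) (x : W) :
    totalDeg T x = #{y | T x y ∨ T y x} := by
  rw [filter_or, card_union_of_disjoint, totalDeg, outNbr, inNbr]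
  exact disjoint_filter.2 fun y _ h h' => hT x y x h h'

theorem totalDeg_le_secondMaxDeg {r x : W} (hr : totalDeg T r = maxDeg T) (hx : x ≠ r) :
    totalDeg T x ≤ secondMaxDeg T := by
  rw [secondMaxDeg, ← insert_erase (mem_univ r), insert_val_of_notMem (notMem_erase r _),
    Multiset.map_cons, hr, Multiset.erase_cons_head]
  exact Multiset.le_sup (Multiset.mem_map_of_mem _ (mem_erase.2 ⟨hx, mem_univ x⟩))

namespace ParentTree

theorem totalDeg_root (hT : Antidirected T)
    (hτ : ∀ x y, (underG T).Adj x y ↔ y ∈ τ.kids x ∨ x ∈ τ.kids y) :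
    totalDeg T τ.root = #(τ.kids τ.root) := by
  rw [hT.totalDeg_eq]
  congr 1
  ext y
  rw [mem_filter_univ, ← hT.underG_adj, hτ]
  exact or_iff_left fun h => (mem_kids.1 h).1 rfl

theorem totalDeg_of_ne_root (hT : Antidirected T)
    (hτ : ∀ x y, (underG T).Adj x y ↔ y ∈ τ.kids x ∨ x ∈ τ.kids y) {x : W} (hx : x ≠ τ.root) :
    totalDeg T x = #(τ.kids x) + 1 := by
  have hpar : τ.par x ∉ τ.kids x := fun h => by
    obtain ⟨h1, h2⟩ := mem_kids.1 h
    have h3 := τ.dep_par _ h1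
    rw [h2] at h3
    exact h3.asymm (τ.dep_par _ hx)
  rw [hT.totalDeg_eq, ← card_insert_of_notMem hpar]
  congr 1
  ext y
  rw [mem_filter_univ, ← hT.underG_adj, hτ, mem_insert, or_comm, mem_kids (w := x),
    and_iff_right hx, eq_comm]

theorem card_eq_arcCount_add_one (hT : Antidirected T)
    (hτ : ∀ x y, (underG T).Adj x y ↔ y ∈ τ.kids x ∨ x ∈ τ.kids y) :
    Fintype.card W = arcCount T + 1 := by
  have h1 : ∑ x, totalDeg T x = 2 * arcCount T := by
    have h2 := sum_card_nbr T true
    have h3 := sum_card_nbr T false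
    simp only [nbr, if_true, Bool.false_eq_true, if_false] at h2 h3
    simp only [totalDeg, sum_add_distrib, h2, h3, two_mul]
  have h2 : ∑ x ∈ univ.erase τ.root, totalDeg T x
      = ∑ x ∈ univ.erase τ.root, #(τ.kids x) + #(univ.erase τ.root) := by
    rw [card_eq_sum_ones, ← sum_add_distrib]
    exact sum_congr rfl fun x hx => totalDeg_of_ne_root hT hτ (mem_erase.1 hx).1
  have h3 := τ.sum_card_kids_add_one
  have h4 := card_erase_add_one (mem_univ τ.root)
  rw [← add_sum_erase _ _ (mem_univ τ.root)] at h1 h3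
  rw [card_univ] at h4
  rw [h2, totalDeg_root hT hτ] at h1
  omega

theorem exists_embedding_of_card_eq_two {V : Type*} {N : Bool → V → Finset V} {s : W → Bool}
    (hself : ∀ b v, v ∉ N b v) (hW : Fintype.card W = 2) {u v : V} (huv : v ∈ N (s τ.root) u) :
    ∃ g : W → V, g.Injective ∧ ∀ w, w ≠ τ.root → g w ∈ N (s (τ.par w)) (g (τ.par w)) := by
  have huniq : ∀ a b, a ≠ τ.root → b ≠ τ.root → a = b := by
    intro a b ha hb
    by_contra hab
    have h1 := card_le_univ ({τ.root, a, b} : Finset W)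
    rw [card_eq_three.2 ⟨_, _, _, ha.symm, hb.symm, hab, rfl⟩, hW] at h1
    omega
  have hne : v ≠ u := fun e => hself _ _ (e ▸ huv)
  refine ⟨fun w => if w = τ.root then u else v, fun a b hab => ?_, fun w hw => ?_⟩
  · by_cases ha : a = τ.root <;> by_cases hb : b = τ.root
    · rw [ha, hb]
    · simp [ha, hb, hne.symm] at hab
    · simp [ha, hb, hne] at hab
    · exact huniq a b ha hb
  · have hpar : τ.par w = τ.root := by
      by_contra h
      exact ne_of_mem_kids (mem_kids_par hw) (huniq _ _ hw h)
    simpa [hpar, hw] using huv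

end ParentTree

end Tree

/-- If `Δ₂(T) ≤ ⌊k/4⌋ + 2`, then the antidirected tree `T` with `k` arcs
embeds in every `𝒦_{2,s}`-free digraph with more than `(k−1)·n` arcs. -/
theorem stmt_3 (k : ℕ) (hk : 0 < k)
    {V : Type*} [Fintype V] [DecidableEq V]
    (D : V → V → Bool) (hloop : Loopless D)
    (hfree : K2sFree D ((k + 11) / 12))
    (harcs : (k - 1) * Fintype.card V < arcCount D)
    {W : Type*} [Fintype W] [DecidableEq W]
    (T : W → W → Bool) (hT : Antidirected T)
    (htree : (underG T).IsTree) (hkT : arcCount T = k)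
    (hD2 : secondMaxDeg T ≤ k / 4 + 2) :
    Embeds T D := by
  obtain ⟨c, hc⟩ : ∃ c, (k + 11) / 12 = c + 1 := ⟨(k + 11) / 12 - 1, by omega⟩
  rw [hc] at hfree
  have hN := hfree.sparseNbr hloop
  have := htree.connected.nonempty
  obtain ⟨r, -, hr⟩ := exists_mem_eq_sup univ univ_nonempty (totalDeg T)
  obtain ⟨τ, rfl, hτ⟩ := ParentTree.exists_adj_iff htree r
  have hcard := ParentTree.card_eq_arcCount_add_one hT hτ
  rw [hkT] at hcard
  have harc : ∀ w, w ≠ τ.root → T w (τ.par w) ∨ T (τ.par w) w := fun w hw =>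
    hT.underG_adj.1 ((hτ _ _).2 (Or.inr (ParentTree.mem_kids_par hw)))
  let s : W → Bool := fun w => decide (∃ v, T w v)
  have hs1 : ∀ {x y}, T x y → s x = true := fun h => decide_eq_true ⟨_, h⟩
  have hs2 : ∀ {x y}, T x y → s y = false := fun h =>
    decide_eq_false fun ⟨_, h'⟩ => hT _ _ _ h h'
  obtain ⟨g, hg, hgm⟩ : ∃ g : W → V, g.Injective ∧
      ∀ w, w ≠ τ.root → g w ∈ nbr D (s (τ.par w)) (g (τ.par w)) := by
    rw [← sum_card_nbr D (s τ.root)] at harcs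
    rcases Nat.eq_zero_or_pos c with rfl | hc0
    · have hsum := hN.sum_card_le (s τ.root)
      have hk1 : k = 1 := by
        by_contra hk1
        have := Nat.mul_le_mul_right (Fintype.card V) (show 1 ≤ k - 1 by omega)
        omega
      obtain ⟨u, -, hu⟩ := exists_ne_zero_of_sum_ne_zero (Nat.ne_zero_of_lt harcs)
      obtain ⟨v, hv⟩ := card_ne_zero.1 hu
      exact ParentTree.exists_embedding_of_card_eq_two hN.self (by omega) hv
    · refine ParentTree.exists_embedding hN ⟨hcard, hc0, by omega, fun x hx => ?_, fun x hx => ?_⟩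
        (fun w hw => ?_) harcs
      · have := totalDeg_le_secondMaxDeg hr.symm hx
        rw [ParentTree.totalDeg_of_ne_root hT hτ hx] at this
        omega
      · rw [← ParentTree.totalDeg_of_ne_root hT hτ hx, ← ParentTree.totalDeg_root hT hτ, ← hr]
        exact le_sup (mem_univ x)
      · rcases harc w hw with h | h
        · rw [hs1 h, hs2 h, Bool.not_false]
        · rw [hs1 h, hs2 h, Bool.not_true]
  refine ⟨g, hg, fun x y hxy => ?_⟩
  rcases (hτ x y).1 (hT.underG_adj.2 (Or.inl hxy)) with h | h
  · obtain ⟨h1, rfl⟩ := ParentTree.mem_kids.1 h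
    have := hgm y h1
    rw [hs1 hxy] at this
    exact mem_nbr_true.1 this
  · obtain ⟨h1, rfl⟩ := ParentTree.mem_kids.1 h
    have := hgm x h1
    rw [hs2 hxy] at this
    exact mem_nbr_false.1 this
end
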